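/- arXiv:1211.2131 — 9 statements merged into one kernel-verified Lean document; each statement's English description precedes it below -/
import Mathlib

section
/- Let n ≥ 3 and let A_1, A_2 be real symmetric n×n matrices. The system ⟨A_1, X⟩ = 0, ⟨A_2, X⟩ = 0, X positive semidefinite, has a rank-one solution if and only if for all t_1, t_2 ∈ ℝ the matrix t_1 A_1 + t_2 A_2 is not positive definite. -/
open Matrix

theorem exists_common_zero_of_segment {V : Type*} [AddCommGroup V] [Module ℝ V]
    {P Q : LinearMap.BilinForm ℝ V} (hP : P.IsSymm) (hQ : Q.IsSymm) {u v : V}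
    (hu : 0 < P u u) (hv : P v v < 0) (hQu : Q u u = 0) (hQv : Q v v = 0) (hQuv : Q u v = 0) :
    ∃ w : V, w ≠ 0 ∧ P w w = 0 ∧ Q w w = 0 := by
  have hPvu := hP.eq v u
  have hQvu := hQ.eq v u
  have hexp : ∀ t : ℝ, P ((1 - t) • u + t • v) ((1 - t) • u + t • v) =
      (1 - t) ^ 2 * P u u + 2 * (t * (1 - t)) * P u v + t ^ 2 * P v v := by
    intro t
    simp only [map_add, map_smul, LinearMap.add_apply, LinearMap.smul_apply, smul_eq_mul, ← hPvu]
    ring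
  obtain ⟨t, -, ht⟩ : ∃ t ∈ Set.Icc (0 : ℝ) 1,
      (1 - t) ^ 2 * P u u + 2 * (t * (1 - t)) * P u v + t ^ 2 * P v v = 0 :=
    intermediate_value_Icc' zero_le_one (by fun_prop) ⟨by simpa using hv.le, by simpa using hu.le⟩
  refine ⟨(1 - t) • u + t • v, fun h => ?_, (hexp t).trans ht, ?_⟩
  · have h1 : (1 - t) • u = -(t • v) := eq_neg_of_add_eq_zero_left h
    have h2 : (1 - t) ^ 2 * P u u = t ^ 2 * P v v := by
      have := congrArg (fun z => P z z) h1
      simp only [map_neg, LinearMap.neg_apply, map_smul, LinearMap.smul_apply, smul_eq_mul] at this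
      linarith
    have h3 : t = 0 := by
      by_contra h0
      have : 0 < t ^ 2 := by positivity
      nlinarith [mul_nonneg (sq_nonneg (1 - t)) hu.le]
    subst h3
    simp at h2
    linarith
  · simp [hQu, hQv, hQuv, show Q v u = 0 by rw [← hQuv, ← hQvu]]

theorem exists_common_zero_of_isotropic {V : Type*} [AddCommGroup V] [Module ℝ V]
    {P Q : LinearMap.BilinForm ℝ V} (hP : P.IsSymm) (hQ : Q.IsSymm)
    (hV : 3 ≤ Module.finrank ℝ V) {x y : V}
    (hx : 0 < P x x) (hy : P y y < 0) (hQx : Q x x = 0) (hQy : Q y y = 0) :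
    ∃ w : V, w ≠ 0 ∧ P w w = 0 ∧ Q w w = 0 := by
  classical
  have hPs := hP.eq
  have hQs := hQ.eq
  by_cases hr : Q x y = 0
  · exact exists_common_zero_of_segment hP hQ hx hy hQx hQy hr
  obtain ⟨z₀, hz₀⟩ : ∃ z, z ∉ Submodule.span ℝ {x, y} := by
    by_contra! h
    have htop : Submodule.span ℝ {x, y} = ⊤ := Submodule.eq_top_iff'.2 h
    have h1 := finrank_span_finset_le_card (R := ℝ) ({x, y} : Finset V)
    rw [Set.finrank, Finset.coe_pair, htop, finrank_top] at h1
    have := Finset.card_le_two (a := x) (b := y)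
    omega
  -- the component of `z₀` that is `Q`-orthogonal to the plane spanned by `x` and `y`
  obtain ⟨z, hz, hxz, hyz⟩ : ∃ z, z ∉ Submodule.span ℝ {x, y} ∧ Q x z = 0 ∧ Q y z = 0 := by
    refine ⟨z₀ - ((Q y z₀ / Q x y) • x + (Q x z₀ / Q x y) • y), fun h => hz₀ ?_, ?_, ?_⟩
    · have := Submodule.add_mem _ h (Submodule.mem_span_pair.2
        ⟨Q y z₀ / Q x y, Q x z₀ / Q x y, rfl⟩)
      simpa using this
    · simp [hQx, hr]
    · simp [hQy, hQs y x, hr]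
  have hzx : Q z x = 0 := (hQs _ _).symm.trans hxz
  have hzy : Q z y = 0 := (hQs _ _).symm.trans hyz
  have hz0 : z ≠ 0 := fun h => hz (h ▸ Submodule.zero_mem _)
  by_cases hw : Q z z = 0
  · rcases lt_trichotomy (P z z) 0 with h | h | h
    · exact exists_common_zero_of_segment hP hQ hx h hQx hw hxz
    · exact ⟨z, hz0, h, hw⟩
    · exact exists_common_zero_of_segment hP hQ h hy hw hQy hzy
  obtain ⟨k, hk⟩ : ∃ k, k = -Q z z / (2 * Q x y) := ⟨_, rfl⟩
  have hk0 : k ≠ 0 := by rw [hk]; exact div_ne_zero (neg_ne_zero.2 hw) (by simpa using hr)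
  have hkQ : 2 * k * Q x y + Q z z = 0 := by rw [hk]; field_simp; ring
  let p : ℝ → V := fun t => ((1 - t) ^ 2) • x + (k * t ^ 2) • y + (t * (1 - t)) • z
  have hexp : ∀ B : LinearMap.BilinForm ℝ V, (∀ a b, B a b = B b a) → ∀ t, B (p t) (p t) =
      (1 - t) ^ 4 * B x x + k ^ 2 * t ^ 4 * B y y + t ^ 2 * (1 - t) ^ 2 * B z z +
      2 * (k * t ^ 2 * (1 - t) ^ 2) * B x y + 2 * (t * (1 - t) ^ 3) * B x z +
      2 * (k * t ^ 3 * (1 - t)) * B y z := by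
    intro B hB t
    simp only [p, map_add, map_smul, LinearMap.add_apply, LinearMap.smul_apply, smul_eq_mul,
      hB y x, hB z x, hB z y]
    ring
  have hcont : Continuous fun t => P (p t) (p t) := by
    simp only [hexp P hPs]
    fun_prop
  have hp1 : P (p 1) (p 1) < 0 := by
    rw [hexp P hPs]
    have : 0 < k ^ 2 := by positivity
    nlinarith
  have hp0 : 0 < P (p 0) (p 0) := by
    simpa [p] using hx
  obtain ⟨t, -, ht⟩ : ∃ t ∈ Set.Icc (0 : ℝ) 1, P (p t) (p t) = 0 :=
    intermediate_value_Icc' zero_le_one hcont.continuousOn ⟨hp1.le, hp0.le⟩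
  refine ⟨p t, fun h => ?_, ht, ?_⟩
  · have ht0 : t ≠ 0 := by rintro rfl; exact hp0.ne' ht
    have ht1 : 1 - t ≠ 0 := by
      intro h1
      obtain rfl : t = 1 := by linarith
      exact hp1.ne ht
    have hmem : (t * (1 - t)) • z ∈ Submodule.span ℝ {x, y} := by
      rw [← neg_eq_of_add_eq_zero_right h]
      exact Submodule.neg_mem _ (Submodule.mem_span_pair.2 ⟨_, _, rfl⟩)
    exact hz ((Submodule.smul_mem_iff _ (mul_ne_zero ht0 ht1)).1 hmem)
  · rw [hexp Q hQs, hQx, hQy, hxz, hyz]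
    linear_combination t ^ 2 * (1 - t) ^ 2 * hkQ

theorem exists_common_zero_of_opposite {V : Type*} [AddCommGroup V] [Module ℝ V]
    {B₁ B₂ : LinearMap.BilinForm ℝ V} (h₁ : B₁.IsSymm) (h₂ : B₂.IsSymm)
    (hV : 3 ≤ Module.finrank ℝ V) {x y : V} (hx : x ≠ 0) (hy : y ≠ 0) {c : ℝ} (hc : 0 ≤ c)
    (hy₁ : B₁ y y = -(c * B₁ x x)) (hy₂ : B₂ y y = -(c * B₂ x x)) :
    ∃ w : V, w ≠ 0 ∧ B₁ w w = 0 ∧ B₂ w w = 0 := by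
  obtain ⟨a, ha⟩ : ∃ a, a = B₁ x x := ⟨_, rfl⟩
  obtain ⟨b, hb⟩ : ∃ b, b = B₂ x x := ⟨_, rfl⟩
  rw [← ha] at hy₁
  rw [← hb] at hy₂
  rcases hc.eq_or_lt with rfl | hc
  · exact ⟨y, hy, by simpa using hy₁, by simpa using hy₂⟩
  by_cases hab : a ^ 2 + b ^ 2 = 0
  · exact ⟨x, hx, by rw [← ha]; nlinarith, by rw [← hb]; nlinarith⟩
  have hpos : 0 < a ^ 2 + b ^ 2 := lt_of_le_of_ne (by positivity) (Ne.symm hab)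
  have hP : (a • B₁ + b • B₂).IsSymm := (h₁.smul a).add (h₂.smul b)
  have hQ : (a • B₂ + (-b) • B₁).IsSymm := (h₂.smul a).add (h₁.smul (-b))
  obtain ⟨w, hw, hPw, hQw⟩ := exists_common_zero_of_isotropic hP hQ hV (x := x) (y := y)
    (by simp [← ha, ← hb]; nlinarith) (by simp [hy₁, hy₂]; nlinarith)
    (by simp [← ha, ← hb]; ring) (by simp [hy₁, hy₂]; ring)
  simp only [LinearMap.add_apply, LinearMap.smul_apply, smul_eq_mul] at hPw hQw
  refine ⟨w, hw, ?_, ?_⟩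
  · refine (mul_eq_zero.1 (?_ : (a ^ 2 + b ^ 2) * B₁ w w = 0)).resolve_left hab
    linear_combination a * hPw - b * hQw
  · refine (mul_eq_zero.1 (?_ : (a ^ 2 + b ^ 2) * B₂ w w = 0)).resolve_left hab
    linear_combination b * hPw + a * hQw

/-- A compact connected family of complex numbers that contains no two points on opposite rays
lies in an open half plane through the origin. -/
theorem exists_re_mul_pos_of_no_opposite {X : Type*} [TopologicalSpace X] {S : Set X}
    (hS : IsCompact S) (hS' : IsConnected S) {f : X → ℂ} (hf : ContinuousOn f S)
    (hopp : ∀ x ∈ S, ∀ y ∈ S, ∀ c : ℝ, 0 ≤ c → f y ≠ -(c * f x)) :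
    ∃ w : ℂ, ∀ x ∈ S, 0 < (f x * w).re := by
  have hne : ∀ x ∈ S, f x ≠ 0 := fun x hx h => hopp x hx x hx 0 le_rfl (by simpa using h)
  obtain ⟨x₀, hx₀⟩ := hS'.nonempty
  have hslit : ∀ x ∈ S, f x / f x₀ ∈ Complex.slitPlane := by
    intro x hx
    rw [Complex.mem_slitPlane_iff_not_le_zero]
    intro hle
    obtain ⟨hre, him⟩ := Complex.le_def.1 hle
    refine hopp x₀ hx₀ x hx (-(f x / f x₀).re) (by simpa using hre) ?_
    have h1 : f x / f x₀ = ((f x / f x₀).re : ℂ) := Complex.ext (by simp) (by simpa using him)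
    rw [Complex.ofReal_neg, ← h1]
    field_simp [hne x₀ hx₀]
  let g : X → ℝ := fun x => (f x / f x₀).arg
  have hg : ContinuousOn g S := fun x hx =>
    (Complex.continuousAt_arg (hslit x hx)).comp_continuousWithinAt
      (f := fun x => f x / f x₀) ((hf x hx).div_const (f x₀))
  obtain ⟨a, ha, hamin⟩ := hS.exists_isMinOn hS'.nonempty hg
  obtain ⟨b, hb, hbmax⟩ := hS.exists_isMaxOn hS'.nonempty hg
  have hpolar : ∀ x, f x / f x₀ = ‖f x / f x₀‖ * Complex.exp (g x * Complex.I) := fun x =>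
    (Complex.norm_mul_exp_arg_mul_I _).symm
  have hlt : g b < g a + Real.pi := by
    by_contra! hge
    obtain ⟨y, hy, hgy⟩ := hS'.isPreconnected.intermediate_value ha hb hg
      (show g a + Real.pi ∈ Set.Icc (g a) (g b) from ⟨by linarith [Real.pi_pos], hge⟩)
    have hna : ‖f a / f x₀‖ ≠ 0 := norm_ne_zero_iff.2 (div_ne_zero (hne a ha) (hne x₀ hx₀))
    refine hopp a ha y hy (‖f y / f x₀‖ / ‖f a / f x₀‖) (by positivity) ?_
    have h1 : f y / f x₀ =
        -(((‖f y / f x₀‖ / ‖f a / f x₀‖ : ℝ) : ℂ) * (f a / f x₀)) := by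
      have hna' : (‖f a / f x₀‖ : ℂ) ≠ 0 := by exact_mod_cast hna
      have hexp : Complex.exp (g a * Complex.I) = f a / f x₀ / ‖f a / f x₀‖ :=
        eq_div_of_mul_eq hna' ((mul_comm _ _).trans (hpolar a).symm)
      conv_lhs => rw [hpolar y, hgy]
      rw [Complex.ofReal_add, add_mul, Complex.exp_add, Complex.exp_pi_mul_I, hexp,
        Complex.ofReal_div]
      ring
    rw [← mul_div_assoc, ← neg_div] at h1
    exact (div_left_inj' (hne x₀ hx₀)).1 h1
  refine ⟨(f x₀)⁻¹ * Complex.exp (-((g a + g b) / 2 : ℝ) * Complex.I), fun x hx => ?_⟩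
  have h1 : f x * ((f x₀)⁻¹ * Complex.exp (-((g a + g b) / 2 : ℝ) * Complex.I)) =
      (‖f x / f x₀‖ : ℝ) * Complex.exp ((g x - (g a + g b) / 2 : ℝ) * Complex.I) := by
    rw [← mul_assoc, ← div_eq_mul_inv]
    conv_lhs => rw [hpolar x]
    rw [mul_assoc, ← Complex.exp_add]
    push_cast
    ring_nf
  rw [h1, Complex.re_ofReal_mul, Complex.exp_ofReal_mul_I_re]
  have hn : 0 < ‖f x / f x₀‖ := norm_pos_iff.2 (div_ne_zero (hne x hx) (hne x₀ hx₀))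
  have h2 : g a ≤ g x := hamin hx
  have h3 : g x ≤ g b := hbmax hx
  exact mul_pos hn (Real.cos_pos_of_mem_Ioo ⟨by linarith, by linarith⟩)

theorem Matrix.IsSymm.toBilin'_isSymm {m R : Type*} [Fintype m] [DecidableEq m] [CommRing R]
    {A : Matrix m m R} (hA : A.IsSymm) : (Matrix.toBilin' A).IsSymm := by
  refine ⟨fun x y => ?_⟩
  simp only [Matrix.toBilin'_apply']
  rw [dotProduct_comm, dotProduct_mulVec, ← mulVec_transpose, hA.eq]

open scoped MatrixOrder in
theorem Matrix.PosDef.trace_mul_pos {m : Type*} [Fintype m] {A X : Matrix m m ℝ}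
    (hA : A.PosDef) (hX : X.PosSemidef) (hX0 : X ≠ 0) : 0 < (A * X).trace := by
  classical
  obtain ⟨B, rfl⟩ := CStarAlgebra.nonneg_iff_eq_star_mul_self.1 hX.nonneg
  rw [star_eq_conjTranspose, ← mul_assoc, trace_mul_comm, ← mul_assoc]
  refine (hA.posSemidef.mul_mul_conjTranspose_same B).trace_nonneg.lt_of_ne fun h => hX0 ?_
  suffices B = 0 by simp [this]
  have h0 := (hA.posSemidef.mul_mul_conjTranspose_same B).trace_eq_zero_iff.1 h.symm
  ext i j
  by_contra hij
  have h1 := hA.dotProduct_mulVec_pos (x := B i) fun h2 => hij (congrFun h2 j)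
  refine h1.ne' ?_
  have h2 := congrFun (congrFun h0 i) i
  rw [mul_assoc] at h2
  simpa [mul_apply, dotProduct, mulVec] using h2

/-- Two real quadratic forms in at least three variables without a common nontrivial zero have a
positive definite linear combination. -/
theorem exists_posDef_of_no_common_zero {n : ℕ} (hn : 3 ≤ n)
    {A₁ A₂ : Matrix (Fin n) (Fin n) ℝ} (hA₁ : A₁.IsSymm) (hA₂ : A₂.IsSymm)
    (h : ∀ x : Fin n → ℝ, x ≠ 0 → x ⬝ᵥ A₁ *ᵥ x = 0 → x ⬝ᵥ A₂ *ᵥ x ≠ 0) :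
    ∃ t₁ t₂ : ℝ, (t₁ • A₁ + t₂ • A₂).PosDef := by
  have hconn : IsConnected (Metric.sphere (0 : Fin n → ℝ) 1) :=
    isConnected_sphere (by rw [rank_fin_fun]; exact_mod_cast (by omega : 1 < n)) 0 zero_le_one
  have hne : ∀ x ∈ Metric.sphere (0 : Fin n → ℝ) 1, x ≠ 0 := fun x hx =>
    ne_zero_of_mem_unit_sphere ⟨x, hx⟩
  obtain ⟨w, hw⟩ := exists_re_mul_pos_of_no_opposite (isCompact_sphere (0 : Fin n → ℝ) 1) hconn
    (f := fun x => ⟨x ⬝ᵥ A₁ *ᵥ x, x ⬝ᵥ A₂ *ᵥ x⟩)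
    (by
      have : Continuous fun x : Fin n → ℝ =>
          ((x ⬝ᵥ A₁ *ᵥ x : ℝ) : ℂ) + (x ⬝ᵥ A₂ *ᵥ x : ℝ) * Complex.I := by fun_prop
      simpa only [Complex.mk_eq_add_mul_I] using this.continuousOn)
    (by
      intro x hx y hy c hc hxy
      obtain ⟨z, hz, hz₁, hz₂⟩ := exists_common_zero_of_opposite hA₁.toBilin'_isSymm
        hA₂.toBilin'_isSymm (by simpa using hn) (hne x hx) (hne y hy) hc
        (by simpa [Matrix.toBilin'_apply'] using congrArg Complex.re hxy)
        (by simpa [Matrix.toBilin'_apply'] using congrArg Complex.im hxy)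
      rw [Matrix.toBilin'_apply'] at hz₁ hz₂
      exact h z hz hz₁ hz₂)
  refine ⟨w.re, -w.im, Matrix.PosDef.of_dotProduct_mulVec_pos ?_ fun {x} hx => ?_⟩
  · exact isHermitian_iff_isSymm.2 ((hA₁.smul _).add (hA₂.smul _))
  · have hnx : 0 < ‖x‖ := norm_pos_iff.2 hx
    have h1 := hw (‖x‖⁻¹ • x) (by simp [norm_smul, hnx.ne'])
    simp only [Complex.mul_re, mulVec_smul, dotProduct_smul, smul_dotProduct, smul_eq_mul] at h1
    have h2 : 0 < ‖x‖⁻¹ ^ 2 * (star x ⬝ᵥ (w.re • A₁ + -w.im • A₂) *ᵥ x) := by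
      simp only [star_trivial, add_mulVec, smul_mulVec, dotProduct_add, dotProduct_smul,
        smul_eq_mul]
      linarith
    exact pos_of_mul_pos_right h2 (by positivity)

theorem stmt_0 {n : ℕ} (hn : 3 ≤ n)
    (A₁ A₂ : Matrix (Fin n) (Fin n) ℝ) (hA₁ : A₁.IsSymm) (hA₂ : A₂.IsSymm) :
    (∃ X : Matrix (Fin n) (Fin n) ℝ, X.PosSemidef ∧ X.rank = 1 ∧
        (A₁ * X).trace = 0 ∧ (A₂ * X).trace = 0) ↔
      ∀ t₁ t₂ : ℝ, ¬ (t₁ • A₁ + t₂ • A₂).PosDef := by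
  constructor
  · rintro ⟨X, hX, hrank, h₁, h₂⟩ t₁ t₂ hpos
    have hX0 : X ≠ 0 := by
      rintro rfl
      simp at hrank
    have := hpos.trace_mul_pos hX hX0
    simp [add_mul, h₁, h₂] at this
  · intro h
    by_contra! hX
    obtain ⟨t₁, t₂, ht⟩ := exists_posDef_of_no_common_zero hn hA₁ hA₂ fun x hx h₁ h₂ => by
      have htr : ∀ A : Matrix (Fin n) (Fin n) ℝ,
          (A * vecMulVec x x).trace = x ⬝ᵥ A *ᵥ x := fun A => by
        rw [mul_vecMulVec, trace_vecMulVec, dotProduct_comm]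
      refine hX (vecMulVec x x) (by simpa using posSemidef_vecMulVec_self_star x) ?_
        ((htr A₁).trans h₁) ((htr A₂).trans h₂)
      refine le_antisymm (rank_vecMulVec_le x x) (Nat.one_le_iff_ne_zero.2 fun h0 => ?_)
      rw [rank, Submodule.finrank_eq_zero, LinearMap.range_eq_bot, ← toLin'_apply',
        LinearEquiv.map_eq_zero_iff, vecMulVec_eq_zero] at h0
      simp [hx] at h0
    exact h t₁ t₂ ht
end

section
/- Let m ≤ n − 1 and let A_1,…,A_m be real symmetric n×n matrices. If there is no x ∈ ℝⁿ with xᵀx = 1 and xᵀ A_i x = 0 for all i = 1,…,m, then there exists a sequence {x^k} ⊂ ℝⁿ with ‖x^k‖ → ∞ as k → ∞ such that for each k there exists a scalar γ^k ∈ (0, ∞) with (x^k)ᵀ A_i x^k = −γ^k x^k_i for i = 1,…,m and (x^k)ᵀ x^k = 1 − γ^k x^k_n, where x^k_j denotes the j-th component of x^k. -/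
open Matrix Filter MeasureTheory

/-- Polynomials of bounded degree are evaluated at `1` by a fixed quadrature formula with nodes
arbitrarily close to `0`. -/
theorem exists_quadrature_eval_one (d : ℕ) {ε : ℝ} (hε : 0 < ε) :
    ∃ v w : Fin (d + 1) → ℝ, (∀ j, 0 < v j ∧ v j < ε) ∧
      ∀ p : Polynomial ℝ, p.natDegree ≤ d → p.eval 1 = ∑ j, w j * p.eval (v j) := by
  let v : Fin (d + 1) → ℝ := fun j => ε / ((j : ℕ) + 2)
  have hv : Function.Injective v := by
    intro i j hij
    have h1 : ((i : ℕ) : ℝ) + 2 ≠ 0 := by positivity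
    have h2 : ((j : ℕ) : ℝ) + 2 ≠ 0 := by positivity
    simp only [v] at hij
    field_simp at hij
    have : ((i : ℕ) : ℝ) = (j : ℕ) := by linarith
    exact Fin.ext (by exact_mod_cast this)
  refine ⟨v, fun j => (Lagrange.basis Finset.univ v j).eval 1, fun j => ⟨by positivity, ?_⟩, ?_⟩
  · exact div_lt_self hε (by have : (0 : ℝ) ≤ (j : ℕ) := by positivity
                             linarith)
  · intro p hp
    have hdeg : p.degree < (Finset.univ : Finset (Fin (d + 1))).card := by
      rw [Finset.card_fin]
      exact lt_of_le_of_lt Polynomial.degree_le_natDegree (by exact_mod_cast Nat.lt_succ_of_le hp)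
    conv_lhs => rw [Lagrange.eq_interpolate hv.injOn hdeg]
    rw [Lagrange.interpolate_apply, Polynomial.eval_finsetSum]
    refine Finset.sum_congr rfl fun j _ => ?_
    simp [mul_comm]

/-- The map `t ↦ det (1 + t T)` is polynomial of degree at most the dimension. -/
theorem exists_polynomial_eval_eq_det_one_add_smul {E : Type*} [AddCommGroup E] [Module ℝ E]
    [FiniteDimensional ℝ E] (T : E →ₗ[ℝ] E) :
    ∃ p : Polynomial ℝ, p.natDegree ≤ Module.finrank ℝ E ∧
      ∀ t : ℝ, p.eval t = LinearMap.det (1 + t • T) := by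
  let b := Module.finBasis ℝ E
  let M := LinearMap.toMatrix b b T
  refine ⟨((Polynomial.X : Polynomial ℝ) • M.map Polynomial.C +
    (1 : Matrix _ _ ℝ).map Polynomial.C).det, ?_, fun t => ?_⟩
  · simpa using Polynomial.natDegree_det_X_add_C_le M 1
  · rw [← LinearMap.det_toMatrix b, map_add, map_smul, LinearMap.toMatrix_one,
      ← Polynomial.coe_evalRingHom, RingHom.map_det]
    congr 1
    ext i j
    by_cases hij : i = j <;> simp [M, hij] <;> ring

section

variable {E : Type*} [NormedAddCommGroup E] [NormedSpace ℝ E]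

/-- Extending by zero outside a ball a function that vanishes on the sphere preserves the
Lipschitz constant. -/
theorem LipschitzOnWith.indicator_closedBall {g : E → E} {ρ : ℝ} {L : NNReal}
    (hg : LipschitzOnWith L g (Metric.closedBall 0 ρ)) (h0 : ∀ x, ‖x‖ = ρ → g x = 0) :
    LipschitzWith L ((Metric.closedBall (0 : E) ρ).indicator g) := by
  set K := Metric.closedBall (0 : E) ρ
  have key : ∀ x ∈ K, ∀ y ∉ K, ‖g x‖ ≤ L * ‖x - y‖ := by
    intro x hx y hy
    have hx' : ‖x‖ ≤ ρ := by simpa [K] using hx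
    have hy' : ρ ≤ ‖y‖ := by
      have : ρ < ‖y‖ := by simpa [K] using hy
      exact this.le
    have hc : ContinuousOn (fun s : ℝ => ‖x + s • (y - x)‖) (Set.Icc 0 1) := by fun_prop
    obtain ⟨s, hs, hsz⟩ := intermediate_value_Icc zero_le_one hc
      (show ρ ∈ Set.Icc _ _ by simpa using ⟨hx', hy'⟩)
    have hz : x + s • (y - x) ∈ K := by
      simp only [K, mem_closedBall_zero_iff]
      exact hsz.le
    have := hg.norm_sub_le hx hz
    rw [h0 _ hsz, sub_zero] at this
    refine this.trans (mul_le_mul_of_nonneg_left ?_ L.2)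
    rw [sub_add_cancel_left, norm_neg, norm_smul, norm_sub_rev y x, Real.norm_of_nonneg hs.1]
    exact mul_le_of_le_one_left (norm_nonneg _) hs.2
  refine LipschitzWith.of_dist_le_mul fun x y => ?_
  rw [dist_eq_norm, dist_eq_norm]
  by_cases hx : x ∈ K <;> by_cases hy : y ∈ K
  · simpa [hx, hy] using hg.norm_sub_le hx hy
  · simpa [hx, hy] using key x hx y hy
  · simpa [hx, hy, norm_sub_rev] using key y hy x hx
  · simp [hx, hy]; positivity

theorem surjective_id_add_of_lipschitz {E : Type*} [NormedAddCommGroup E] [CompleteSpace E]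
    {g : E → E} {c : NNReal} (hc : c < 1)
    (hg : LipschitzWith c g) : Function.Surjective fun x => x + g x := by
  intro y
  have hT : ContractingWith c (fun x => y - g x) :=
    ⟨hc, LipschitzWith.of_dist_le_mul fun a b => by
      simpa [dist_eq_norm, norm_sub_rev] using hg.dist_le_mul b a⟩
  refine ⟨hT.fixedPoint, ?_⟩
  have := hT.fixedPoint_isFixedPt
  simp only [Function.IsFixedPt] at this
  exact (sub_eq_iff_eq_add.1 this).symm

theorem bijOn_closedBall_id_add_smul [CompleteSpace E] {g : E → E} {ρ t : ℝ} {L : NNReal}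
    (hg : LipschitzOnWith L g (Metric.closedBall 0 ρ)) (h0 : ∀ x, ‖x‖ = ρ → g x = 0)
    (hmaps : ∀ x ∈ Metric.closedBall (0 : E) ρ, x + t • g x ∈ Metric.closedBall (0 : E) ρ)
    (ht : 0 ≤ t) (htL : t * L < 1) :
    Set.BijOn (fun x => x + t • g x) (Metric.closedBall 0 ρ) (Metric.closedBall 0 ρ) := by
  refine ⟨hmaps, fun x hx y hy hxy => ?_, fun y hy => ?_⟩
  · have h1 : x - y = t • (g y - g x) := by
      rw [smul_sub, sub_eq_sub_iff_add_eq_add]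
      simpa [add_comm] using hxy
    have h2 : ‖x - y‖ ≤ t * L * ‖x - y‖ := by
      conv_lhs => rw [h1, norm_smul, Real.norm_of_nonneg ht, norm_sub_rev]
      rw [mul_assoc]
      exact mul_le_mul_of_nonneg_left (hg.norm_sub_le hx hy) ht
    have h3 : ‖x - y‖ = 0 := by nlinarith [norm_nonneg (x - y)]
    exact sub_eq_zero.1 (norm_eq_zero.1 h3)
  · have hlip : LipschitzWith (t.toNNReal * L)
        (fun x => t • (Metric.closedBall (0 : E) ρ).indicator g x) :=
      LipschitzWith.of_dist_le_mul fun a b => by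
        rw [dist_smul₀, Real.norm_of_nonneg ht, NNReal.coe_mul, Real.coe_toNNReal t ht, mul_assoc]
        exact mul_le_mul_of_nonneg_left ((hg.indicator_closedBall h0).dist_le_mul a b) ht
    obtain ⟨x, hx⟩ := surjective_id_add_of_lipschitz (by
      rw [← NNReal.coe_lt_coe, NNReal.coe_mul, Real.coe_toNNReal t ht]
      exact_mod_cast htL) hlip y
    by_cases hxK : x ∈ Metric.closedBall (0 : E) ρ
    · exact ⟨x, hxK, by simpa only [Set.indicator_of_mem hxK] using hx⟩
    · simp only [Set.indicator_of_notMem hxK, smul_zero, add_zero] at hx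
      exact absurd (hx ▸ hy) hxK

end

section

variable {E : Type*} [NormedAddCommGroup E] [InnerProductSpace ℝ E]

theorem det_fderiv_eq_zero_of_norm_eq [FiniteDimensional ℝ E] {r : E → E} {ρ : ℝ} (hρ : 0 < ρ)
    (hr : Differentiable ℝ r) (hnorm : ∀ x, ‖r x‖ = ρ) (x : E) : (fderiv ℝ r x).det = 0 := by
  by_contra hdet
  have hu : IsUnit (LinearMap.det (fderiv ℝ r x : E →ₗ[ℝ] E)) := isUnit_iff_ne_zero.2 hdet
  have hbij := (Module.End.isUnit_iff _).1 ((LinearMap.isUnit_iff_isUnit_det _).2 hu)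
  obtain ⟨v, hv⟩ := hbij.2 (r x)
  have hd := ((hr x).hasFDerivAt.inner ℝ (hr x).hasFDerivAt)
  have hconst : (fun y => inner ℝ (r y) (r y)) = fun _ => ρ ^ 2 := by
    funext y
    rw [real_inner_self_eq_norm_sq, hnorm]
  rw [hconst] at hd
  have h0 := congrArg (fun f : E →L[ℝ] ℝ => f v) (hd.unique (hasFDerivAt_const _ _))
  have hv' : fderiv ℝ r x v = r x := hv
  simp [hv', hnorm] at h0
  exact hρ.ne' h0

variable [FiniteDimensional ℝ E]

theorem exists_forall_measure_det_eq {r : E → E} {ρ : ℝ} (hr : ContDiff ℝ 1 r)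
    (hnorm : ∀ x, ‖r x‖ = ρ) (hid : ∀ x, ‖x‖ = ρ → r x = x)
    [MeasurableSpace E] [BorelSpace E] (μ : Measure E) [μ.IsAddHaarMeasure] :
    ∃ ε : ℝ, 0 < ε ∧ ∀ t : ℝ, 0 < t → t < ε →
      ∫ x in Metric.closedBall (0 : E) ρ, (1 + t • (fderiv ℝ r x - 1)).det ∂μ
        = μ.real (Metric.closedBall (0 : E) ρ) := by
  set K := Metric.closedBall (0 : E) ρ
  have hKc : IsCompact K := isCompact_closedBall _ _
  have hDr : Continuous (fderiv ℝ r) := hr.continuous_fderiv one_ne_zero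
  have hrd : Differentiable ℝ r := hr.differentiable one_ne_zero
  let g : E → E := fun x => r x - x
  have hg' : ∀ x, HasFDerivAt g (fderiv ℝ r x - 1) x := fun x =>
    (hrd x).hasFDerivAt.sub (hasFDerivAt_id x)
  obtain ⟨C, hC⟩ := hKc.exists_bound_of_continuousOn
    (f := fun x => fderiv ℝ r x - 1) (by fun_prop)
  have hlip : LipschitzOnWith C.toNNReal g K :=
    (convex_closedBall (0 : E) ρ).lipschitzOnWith_of_nnnorm_hasFDerivWithin_le
      (fun x _ => (hg' x).hasFDerivWithinAt) fun x hx => by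
        rw [← NNReal.coe_le_coe, coe_nnnorm]
        exact (hC x hx).trans (Real.le_coe_toNNReal C)
  have hdet : ∀ᶠ t : ℝ in nhds 0, ∀ x ∈ K, 0 < (1 + t • (fderiv ℝ r x - 1)).det := by
    refine hKc.eventually_forall_of_forall_eventually fun x _ => ?_
    have hc : Continuous fun z : ℝ × E => (1 + z.1 • (fderiv ℝ r z.2 - 1)).det :=
      ContinuousLinearMap.continuous_det.comp (by fun_prop)
    refine hc.continuousAt.eventually_const_lt ?_
    simp [ContinuousLinearMap.det]
  have hsmall : ∀ᶠ t : ℝ in nhds 0, t * C.toNNReal < 1 :=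
    (by fun_prop : Continuous fun t : ℝ => t * (C.toNNReal : ℝ)).continuousAt.eventually_lt_const
      (by simp)
  have hone : ∀ᶠ t : ℝ in nhds 0, t < 1 := eventually_lt_nhds one_pos
  obtain ⟨ε, hε, hball⟩ := Metric.eventually_nhds_iff.1 (hdet.and (hsmall.and hone))
  refine ⟨ε, hε, fun t ht htε => ?_⟩
  obtain ⟨hpos, htL, ht1⟩ := hball (y := t) (by simpa [abs_of_pos ht] using htε)
  have hbij := bijOn_closedBall_id_add_smul hlip
    (fun x hx => by simp [g, hid x hx]) (t := t) (fun x hx => by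
      have : x + t • g x = (1 - t) • x + t • r x := by simp only [g]; module
      rw [this]
      exact convex_closedBall (0 : E) ρ hx (by simp [hnorm]) (by linarith) ht.le (by ring))
    ht.le htL
  have hchange := integral_image_eq_integral_abs_det_fderiv_smul μ (s := K)
    (f := fun x => x + t • g x) (f' := fun x => 1 + t • (fderiv ℝ r x - 1))
    Metric.isClosed_closedBall.measurableSet
    (fun x _ => ((hasFDerivAt_id x).add ((hg' x).const_smul t)).hasFDerivWithinAt)
    hbij.injOn (fun _ => (1 : ℝ))
  rw [hbij.image_eq] at hchange
  simp only [smul_eq_mul, mul_one, integral_const, MeasurableSet.univ, measureReal_restrict_apply,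
    Set.univ_inter] at hchange
  rw [hchange]
  exact setIntegral_congr_fun Metric.isClosed_closedBall.measurableSet fun x hx =>
    (abs_of_pos (hpos x hx)).symm

/-- The `C¹` no-retraction theorem, by the volume argument of Milnor and Rogers. -/
theorem not_exists_contDiff_retraction {r : E → E} {ρ : ℝ} (hρ : 0 < ρ) (hr : ContDiff ℝ 1 r)
    (hnorm : ∀ x, ‖r x‖ = ρ) : ¬ ∀ x, ‖x‖ = ρ → r x = x := by
  intro hid
  borelize E
  let μ : Measure E := volume
  obtain ⟨ε, hε, hint⟩ := exists_forall_measure_det_eq hr hnorm hid μ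
  obtain ⟨v, w, hv, hquad⟩ := exists_quadrature_eval_one (Module.finrank ℝ E) hε
  set K := Metric.closedBall (0 : E) ρ
  have hDr : Continuous (fderiv ℝ r) := hr.continuous_fderiv one_ne_zero
  have hpt : ∀ x, (0 : ℝ) = ∑ j, w j * (1 + v j • (fderiv ℝ r x - 1)).det := by
    intro x
    obtain ⟨p, hp, hpe⟩ := exists_polynomial_eval_eq_det_one_add_smul
      ((fderiv ℝ r x - 1 : E →L[ℝ] E) : E →ₗ[ℝ] E)
    have h1 := hquad p hp
    simp only [hpe] at h1
    have h2 : (1 + (1 : ℝ) • ((fderiv ℝ r x - 1 : E →L[ℝ] E) : E →ₗ[ℝ] E))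
        = (fderiv ℝ r x : E →ₗ[ℝ] E) := by
      ext y; simp
    rw [h2] at h1
    exact (det_fderiv_eq_zero_of_norm_eq hρ (hr.differentiable one_ne_zero) hnorm x).symm.trans h1
  have hone : (1 : ℝ) = ∑ j, w j := by simpa using hquad 1 (by simp)
  have hzero : (0 : ℝ) = ∑ j, w j * μ.real K := by
    calc (0 : ℝ) = ∫ x in K, (0 : ℝ) ∂μ := by simp
      _ = ∫ x in K, ∑ j, w j * (1 + v j • (fderiv ℝ r x - 1)).det ∂μ := by
        simp only [← hpt]
      _ = ∑ j, w j * μ.real K := by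
        rw [integral_finsetSum]
        · refine Finset.sum_congr rfl fun j _ => ?_
          rw [integral_const_mul, hint _ (hv j).1 (hv j).2]
        · intro j _
          refine ContinuousOn.integrableOn_compact (isCompact_closedBall _ _) ?_
          exact (continuous_const.mul
            (ContinuousLinearMap.continuous_det.comp (by fun_prop))).continuousOn
  rw [← Finset.sum_mul, ← hone, one_mul] at hzero
  have hpos : 0 < μ.real K :=
    ENNReal.toReal_pos (Metric.measure_closedBall_pos μ _ hρ).ne'
      (isCompact_closedBall _ _).measure_lt_top.ne
  exact hpos.ne hzero

/-- A `C¹` vector field pointing outwards away from a ball has a zero. -/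
theorem exists_zero_of_inner_pos {F : E → E} {R : ℝ} (hR : 0 < R) (hF : ContDiff ℝ 1 F)
    (hpos : ∀ x, R ≤ ‖x‖ → 0 < inner ℝ (F x) x) : ∃ x, F x = 0 := by
  by_contra! hne
  let χ : ContDiffBump (0 : E) := ⟨R, R + 1, hR, by linarith⟩
  let P : E → E := fun x => χ x • F x + (1 - χ x) • x
  have hP : ∀ x, P x ≠ 0 := by
    intro x
    rcases le_or_gt ‖x‖ R with hx | hx
    · have : χ x = 1 := χ.one_of_mem_closedBall (by simpa [χ] using hx)
      simpa [P, this] using hne x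
    · intro h0
      have h1 : 0 < inner ℝ (P x) x := by
        have hx2 : 0 < ‖x‖ ^ 2 := by have := hR.trans hx; positivity
        have hFx := hpos x hx.le
        simp only [P, inner_add_left, real_inner_smul_left, real_inner_self_eq_norm_sq]
        rcases (χ.nonneg (x := x)).eq_or_lt with h | h
        · rw [← h]; simpa using hx2
        · have := χ.le_one (x := x)
          have := mul_pos h hFx
          have := mul_nonneg (sub_nonneg.2 (χ.le_one (x := x))) hx2.le
          linarith
      rw [h0, inner_zero_left] at h1
      exact h1.false
  have hPc : ContDiff ℝ 1 P :=
    (χ.contDiff.smul hF).add ((contDiff_const.sub χ.contDiff).smul contDiff_id)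
  have hρ : 0 < R + 1 := by linarith
  refine not_exists_contDiff_retraction (r := fun x => ((R + 1) * ‖P x‖⁻¹) • P x) hρ
    ((contDiff_const.mul ((hPc.norm ℝ hP).inv fun x => norm_ne_zero_iff.2 (hP x))).smul hPc)
    (fun x => ?_) fun x hx => ?_
  · rw [norm_smul, Real.norm_of_nonneg (by positivity), mul_assoc,
      inv_mul_cancel₀ (norm_ne_zero_iff.2 (hP x)), mul_one]
  · have h0 : χ x = 0 := χ.zero_of_le_dist (by simp [χ, hx])
    have hPx : P x = x := by simp [P, h0]
    simp only [hPx, hx]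
    rw [mul_inv_cancel₀ hρ.ne', one_smul]

end

section

variable {n m : ℕ}

/-- The point of `ℝⁿ` whose coordinates along `e` are those of `v`, whose `l`-th coordinate is `-1`,
and whose other coordinates vanish. -/
def padNegOne (e : Fin m → Fin n) (l : Fin n) (v : EuclideanSpace ℝ (Fin m)) : Fin n → ℝ :=
  (∑ i, v i • Pi.single (e i) 1) - Pi.single l 1

theorem padNegOne_apply {e : Fin m → Fin n} {l : Fin n} (he : Function.Injective e)
    (hl : ∀ i, e i ≠ l) (v : EuclideanSpace ℝ (Fin m)) (i : Fin m) :
    padNegOne e l v (e i) = v i := by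
  simp [padNegOne, Pi.single_apply, hl, he.eq_iff]

theorem padNegOne_last {e : Fin m → Fin n} {l : Fin n} (hl : ∀ i, e i ≠ l)
    (v : EuclideanSpace ℝ (Fin m)) : padNegOne e l v l = -1 := by
  simp [padNegOne, fun i => (hl i).symm]

theorem padNegOne_dotProduct_self {e : Fin m → Fin n} {l : Fin n} (he : Function.Injective e)
    (hl : ∀ i, e i ≠ l) (v : EuclideanSpace ℝ (Fin m)) :
    padNegOne e l v ⬝ᵥ padNegOne e l v = 1 + ‖v‖ ^ 2 := by
  conv_lhs => enter [1]; rw [padNegOne]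
  simp only [sub_dotProduct, sum_dotProduct, smul_dotProduct, single_dotProduct, one_mul,
    padNegOne_apply he hl, padNegOne_last hl, EuclideanSpace.real_norm_sq_eq, smul_eq_mul]
  simp only [pow_two]
  ring

theorem contDiff_padNegOne (e : Fin m → Fin n) (l j : Fin n) :
    ContDiff ℝ 1 fun v => padNegOne e l v j := by
  simp only [padNegOne, Pi.sub_apply, Finset.sum_apply, Pi.smul_apply]
  fun_prop

theorem Matrix.exists_abs_dotProduct_mulVec_le (A : Matrix (Fin n) (Fin n) ℝ) :
    ∃ C : ℝ, 0 ≤ C ∧ ∀ x, |x ⬝ᵥ A *ᵥ x| ≤ C * (x ⬝ᵥ x) := by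
  refine ⟨∑ i, ∑ j, |A i j|, by positivity, fun x => ?_⟩
  have hsq (i : Fin n) : x i * x i ≤ x ⬝ᵥ x :=
    Finset.single_le_sum (f := fun i => x i * x i) (fun i _ => mul_self_nonneg _)
      (Finset.mem_univ i)
  simp only [dotProduct.eq_1 x (A *ᵥ x), mulVec, dotProduct.eq_1 (fun _ => A _ _), Finset.mul_sum,
    Finset.sum_mul]
  refine (Finset.abs_sum_le_sum_abs _ _).trans (Finset.sum_le_sum fun i _ => ?_)
  refine (Finset.abs_sum_le_sum_abs _ _).trans (Finset.sum_le_sum fun j _ => ?_)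
  have hij : |x i * x j| ≤ x ⬝ᵥ x := by
    have := hsq i
    have := hsq j
    rw [abs_le]
    constructor <;> nlinarith [sq_nonneg (x i + x j), sq_nonneg (x i - x j)]
  calc |x i * (A i j * x j)| = |A i j| * |x i * x j| := by rw [← abs_mul]; ring_nf
    _ ≤ _ := mul_le_mul_of_nonneg_left hij (abs_nonneg _)

theorem exists_quadratic_eq_neg_smul {e : Fin m → Fin n} {l : Fin n} (he : Function.Injective e)
    (hl : ∀ i, e i ≠ l) (A : Fin m → Matrix (Fin n) (Fin n) ℝ)
    {c : ℝ} (hc : 0 < c) : ∃ v : EuclideanSpace ℝ (Fin m), ∀ i,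
      padNegOne e l v ⬝ᵥ A i *ᵥ padNegOne e l v = -(c * (1 + ‖v‖ ^ 2) * v i) := by
  choose C hC0 hC using fun i => (A i).exists_abs_dotProduct_mulVec_le
  let F : EuclideanSpace ℝ (Fin m) → EuclideanSpace ℝ (Fin m) := fun v => WithLp.toLp 2 fun i =>
    c * (1 + ‖v‖ ^ 2) * v i + padNegOne e l v ⬝ᵥ A i *ᵥ padNegOne e l v
  have hF : ContDiff ℝ 1 F := by
    rw [contDiff_euclidean]
    intro i
    have hX := contDiff_padNegOne e l
    have hn : ContDiff ℝ 1 fun v : EuclideanSpace ℝ (Fin m) => ‖v‖ ^ 2 := contDiff_norm_sq ℝ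
    simp only [F, dotProduct, mulVec]
    fun_prop
  have hCsum : 0 ≤ ∑ i, C i := Finset.sum_nonneg fun i _ => hC0 i
  obtain ⟨v, hv⟩ := exists_zero_of_inner_pos (R := (∑ i, C i + 1) / c) (by positivity) hF
    fun v hv => by
      have hinner : inner ℝ (F v) v = c * (1 + ‖v‖ ^ 2) * ‖v‖ ^ 2 +
          ∑ i, padNegOne e l v ⬝ᵥ A i *ᵥ padNegOne e l v * v i := by
        rw [PiLp.inner_apply, EuclideanSpace.real_norm_sq_eq v, Finset.mul_sum,
          ← Finset.sum_add_distrib]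
        refine Finset.sum_congr rfl fun i _ => ?_
        simp [F, EuclideanSpace.real_norm_sq_eq v]
        ring
      have hsum : -((∑ i, C i) * (1 + ‖v‖ ^ 2) * ‖v‖) ≤
          ∑ i, padNegOne e l v ⬝ᵥ A i *ᵥ padNegOne e l v * v i := by
        rw [Finset.sum_mul, Finset.sum_mul, ← Finset.sum_neg_distrib]
        refine Finset.sum_le_sum fun i _ => neg_le_of_abs_le ?_
        rw [abs_mul]
        have h1 := hC i (padNegOne e l v)
        rw [padNegOne_dotProduct_self he hl] at h1
        exact mul_le_mul h1 (PiLp.norm_apply_le v i) (abs_nonneg _) ((abs_nonneg _).trans h1)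
      have hvpos : 0 < ‖v‖ := lt_of_lt_of_le (by positivity) hv
      rw [div_le_iff₀ hc] at hv
      have : 0 < (1 + ‖v‖ ^ 2) * ‖v‖ * (‖v‖ * c - ∑ i, C i) :=
        mul_pos (by positivity) (by linarith)
      rw [hinner]
      linarith
  refine ⟨v, fun i => ?_⟩
  have := congrArg (fun y : EuclideanSpace ℝ (Fin m) => y i) hv
  simp only [F, PiLp.zero_apply] at this
  linarith

theorem exists_quadratic_eq_neg_smul_of_radius {e : Fin m → Fin n} {l : Fin n}
    (he : Function.Injective e) (hl : ∀ i, e i ≠ l)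
    (A : Fin m → Matrix (Fin n) (Fin n) ℝ) {r : ℝ} (hr : 1 < r) :
    ∃ x : Fin n → ℝ, Real.sqrt (x ⬝ᵥ x) = r ∧ ∃ γ : ℝ, 0 < γ ∧
      (∀ i : Fin m, x ⬝ᵥ (A i) *ᵥ x = -γ * x (e i)) ∧
      x ⬝ᵥ x = 1 - γ * x l := by
  have hr0 : 0 < r := by linarith
  have hr2 : 0 < r ^ 2 - 1 := by nlinarith
  obtain ⟨v, hv⟩ := exists_quadratic_eq_neg_smul he hl A (c := (r ^ 2 - 1) / r ^ 2) (by positivity)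
  obtain ⟨s, hs, hs2⟩ : ∃ s : ℝ, 0 < s ∧ s ^ 2 * (1 + ‖v‖ ^ 2) = r ^ 2 := by
    refine ⟨r / Real.sqrt (1 + ‖v‖ ^ 2), by positivity, ?_⟩
    rw [div_pow, Real.sq_sqrt (by positivity)]
    field_simp
  have hself : (s • padNegOne e l v) ⬝ᵥ (s • padNegOne e l v) = r ^ 2 := by
    rw [smul_dotProduct, dotProduct_smul, padNegOne_dotProduct_self he hl, smul_eq_mul, smul_eq_mul,
      ← hs2]
    ring
  refine ⟨s • padNegOne e l v, ?_, (r ^ 2 - 1) / s, by positivity, fun i => ?_, ?_⟩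
  · rw [hself, Real.sqrt_sq hr0.le]
  · rw [mulVec_smul, smul_dotProduct, dotProduct_smul, hv, Pi.smul_apply, padNegOne_apply he hl]
    simp only [smul_eq_mul]
    calc s * (s * -((r ^ 2 - 1) / r ^ 2 * (1 + ‖v‖ ^ 2) * v i))
        = -((r ^ 2 - 1) / r ^ 2 * (s ^ 2 * (1 + ‖v‖ ^ 2)) * v i) := by ring
      _ = -((r ^ 2 - 1) / s) * (s * v i) := by rw [hs2]; field_simp
  · rw [hself, Pi.smul_apply, padNegOne_last hl, smul_eq_mul]
    field_simp
    ring

end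

theorem stmt_2 {n m : ℕ} (hmn : m + 1 ≤ n)
    (A : Fin m → Matrix (Fin n) (Fin n) ℝ) (hA : ∀ i, (A i).IsSymm)
    (h : ¬ ∃ x : Fin n → ℝ, x ⬝ᵥ x = 1 ∧ ∀ i, x ⬝ᵥ (A i) *ᵥ x = 0) :
    ∃ x : ℕ → (Fin n → ℝ),
      Tendsto (fun k => Real.sqrt (x k ⬝ᵥ x k)) atTop atTop ∧
      ∀ k, ∃ γ : ℝ, 0 < γ ∧
        (∀ i : Fin m,
          x k ⬝ᵥ (A i) *ᵥ x k = -γ * x k (Fin.castLE (by omega) i)) ∧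
        x k ⬝ᵥ x k = 1 - γ * x k ⟨n - 1, by omega⟩ := by
  have hl (i : Fin m) : Fin.castLE (by omega) i ≠ (⟨n - 1, by omega⟩ : Fin n) := by
    simp only [ne_eq, Fin.ext_iff, Fin.val_castLE]
    omega
  choose x hx hγ using fun k : ℕ =>
    exists_quadratic_eq_neg_smul_of_radius (Fin.castLE_injective _) hl A (r := (k : ℝ) + 2)
      (by have := k.cast_nonneg (α := ℝ); linarith)
  refine ⟨x, ?_, hγ⟩
  simp only [hx]
  exact tendsto_atTop_add_const_right _ _ tendsto_natCast_atTop_atTop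
end

section
/- Let m ≤ n − 1 and let A_1,…,A_m be real symmetric n×n matrices. Suppose that for every x ∈ ℝⁿ with ‖x‖ = 1 and x_n < 0, either xᵀ A_i x = 0 for all i = 1,…,m, or there exists an index i ∈ {1,…,m} with xᵀ A_i x ≠ 0 and x_i (xᵀ A_i x) ≥ 0 (i.e., max over {i : xᵀ A_i x ≠ 0} of x_i(xᵀ A_i x) is ≥ 0). Then the system ⟨A_i, X⟩ = 0 for i = 1,…,m, X positive semidefinite, has a rank-one solution. -/
open Matrix

/-- Lagrange interpolation for the polynomial function `t ↦ det (1 + t M)`. -/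
theorem det_one_add_smul_eq_sum {E : Type*} [NormedAddCommGroup E] [NormedSpace ℝ E]
    [FiniteDimensional ℝ E] (s : Finset ℝ) (hs : Module.finrank ℝ E < s.card) (M : E →L[ℝ] E)
    (t : ℝ) :
    (ContinuousLinearMap.id ℝ E + t • M).det =
      ∑ i ∈ s, (ContinuousLinearMap.id ℝ E + i • M).det * (Lagrange.basis s id i).eval t := by
  classical
  let b := Module.finBasis ℝ E
  let N := LinearMap.toMatrix b b (M : E →ₗ[ℝ] E)
  let p : Polynomial ℝ := det ((Polynomial.X : Polynomial ℝ) • N.map Polynomial.C +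
    (1 : Matrix _ _ ℝ).map Polynomial.C)
  have hp : ∀ t : ℝ, p.eval t = (ContinuousLinearMap.id ℝ E + t • M).det := by
    intro t
    have h1 : (ContinuousLinearMap.id ℝ E + t • M).det = (1 + t • N).det := by
      rw [ContinuousLinearMap.det, ← LinearMap.det_toMatrix b]
      congr 1
      simp [N]
    rw [h1]
    simp only [p]
    rw [← Polynomial.coe_evalRingHom, RingHom.map_det]
    congr 1
    ext i j
    simp [Matrix.one_apply, add_comm, apply_ite, mul_comm t]
  have hdeg : p.degree < s.card := by
    refine lt_of_le_of_lt Polynomial.degree_le_natDegree ?_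
    have := Polynomial.natDegree_det_X_add_C_le N 1
    rw [Fintype.card_fin] at this
    exact_mod_cast this.trans_lt hs
  have h := Lagrange.eq_interpolate (s := s) (v := id) (f := p) Function.injective_id.injOn hdeg
  rw [← hp, h, Lagrange.interpolate_apply, Polynomial.eval_finsetSum]
  simp [hp]

open MeasureTheory Metric in
/-- There is no `C¹` map to the unit sphere that fixes the unit sphere pointwise. -/
theorem not_exists_contDiff_retraction_sphere {E : Type*} [NormedAddCommGroup E]
    [InnerProductSpace ℝ E] [FiniteDimensional ℝ E] {r : E → E} (hr : ContDiff ℝ 1 r)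
    (hnorm : ∀ x, ‖r x‖ = 1) (hfix : ∀ x, ‖x‖ = 1 → r x = x) : False := by
  let : MeasurableSpace E := borel E
  have : BorelSpace E := ⟨rfl⟩
  let B : Set E := closedBall 0 1
  have hB : IsCompact B := isCompact_closedBall 0 1
  have memB : ∀ x, x ∈ B ↔ ‖x‖ ≤ 1 := fun x => by simp [B]
  have hc : ContDiff ℝ 1 (fun x => r x - x) := hr.sub contDiff_id
  obtain ⟨K, hK⟩ := hc.contDiffOn.exists_lipschitzOnWith one_ne_zero (convex_closedBall (0:E) 1) hB
  have hK' : ∀ x y, ‖x‖ ≤ 1 → ‖y‖ ≤ 1 → ‖(r x - x) - (r y - y)‖ ≤ K * ‖x - y‖ := fun x y hx hy =>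
    hK.norm_sub_le ((memB x).2 hx) ((memB y).2 hy)
  let D : E → E →L[ℝ] E := fun y => fderiv ℝ r y - ContinuousLinearMap.id ℝ E
  have hD : Continuous D := (hr.continuous_fderiv one_ne_zero).sub continuous_const
  let J : ℝ → E → ℝ := fun t y => (ContinuousLinearMap.id ℝ E + t • D y).det
  have hJ : Continuous (fun z : ℝ × E => J z.1 z.2) := by
    refine ContinuousLinearMap.continuous_det.comp ?_
    exact continuous_const.add (continuous_fst.smul (hD.comp continuous_snd))
  have hpos : ∀ᶠ t in nhds (0:ℝ), ∀ y ∈ B, 0 < J t y := by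
    refine hB.eventually_forall_of_forall_eventually fun y _ => ?_
    refine hJ.continuousAt.eventually (lt_mem_nhds ?_)
    simp [J, ContinuousLinearMap.det]
  have hJ1 : ∀ y, J 1 y = 0 := by
    intro y
    have e : J 1 y = (fderiv ℝ r y).det := by simp [J, D]
    rw [e]
    have hd : HasFDerivAt r (fderiv ℝ r y) y := (hr.differentiable one_ne_zero y).hasFDerivAt
    have horth : ∀ v, inner ℝ (r y) (fderiv ℝ r y v) = 0 := by
      intro v
      have h1 := (hd.norm_sq)
      have h2 : HasFDerivAt (fun x => ‖r x‖ ^ 2) (0 : E →L[ℝ] ℝ) y := by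
        simp only [hnorm]; exact hasFDerivAt_const _ _
      have h3 := congrArg (fun L : E →L[ℝ] ℝ => L v) (h1.unique h2)
      simpa using h3
    by_contra hne
    have hu : IsUnit (fderiv ℝ r y : E →ₗ[ℝ] E) :=
      (LinearMap.isUnit_iff_isUnit_det _).2 (isUnit_iff_ne_zero.2 hne)
    obtain ⟨v, hv⟩ := ((Module.End.isUnit_iff _).1 hu).2 (r y)
    have := horth v
    rw [show fderiv ℝ r y v = r y from hv, real_inner_self_eq_norm_sq, hnorm] at this
    norm_num at this
  have himage : ∀ t : ℝ, 0 < t → t < 1 → t * K < 1 →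
      Set.InjOn (fun y => y + t • (r y - y)) B ∧ (fun y => y + t • (r y - y)) '' B = B := by
    intro t ht0 ht1 htK
    refine ⟨?_, Set.Subset.antisymm ?_ ?_⟩
    · intro x hx y hy hxy
      simp only at hxy
      have h1 : x - y = -(t • ((r x - x) - (r y - y))) := by
        rw [smul_sub, neg_sub, sub_eq_sub_iff_add_eq_add, hxy, add_comm]
      have h2 : ‖x - y‖ ≤ t * (K * ‖x - y‖) := by
        calc ‖x - y‖ = t * ‖(r x - x) - (r y - y)‖ := by
              conv_lhs => rw [h1]
              rw [norm_neg, norm_smul, Real.norm_of_nonneg ht0.le]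
          _ ≤ _ := by gcongr; exact hK' x y ((memB x).1 hx) ((memB y).1 hy)
      have h3 : ‖x - y‖ = 0 := by nlinarith [norm_nonneg (x - y)]
      exact sub_eq_zero.1 (norm_eq_zero.1 h3)
    · rintro _ ⟨y, hy, rfl⟩
      rw [memB] at hy ⊢
      have : y + t • (r y - y) = (1 - t) • y + t • r y := by module
      simp only [this]
      refine (norm_add_le _ _).trans ?_
      rw [norm_smul, norm_smul, hnorm, Real.norm_of_nonneg ht0.le,
        Real.norm_of_nonneg (by linarith)]
      nlinarith
    · intro w hw
      classical
      let H : E → E := fun y => if ‖y‖ ≤ 1 then r y - y else 0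
      have hmix : ∀ x y, ‖x‖ ≤ 1 → 1 < ‖y‖ → ‖r x - x‖ ≤ K * ‖x - y‖ := by
        intro x y hx hy
        have hy0 : (0:ℝ) < ‖y‖ := by linarith
        have hz : ‖(‖y‖⁻¹ • y : E)‖ = 1 := by
          rw [norm_smul, norm_inv, norm_norm, inv_mul_cancel₀ hy0.ne']
        have h1 := hK' x (‖y‖⁻¹ • y) hx hz.le
        rw [hfix _ hz, sub_self, sub_zero] at h1
        refine h1.trans (mul_le_mul_of_nonneg_left ?_ K.2)
        refine (sq_le_sq₀ (norm_nonneg _) (norm_nonneg _)).1 ?_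
        rw [norm_sub_sq_real, norm_sub_sq_real, hz, real_inner_smul_right]
        have hp : inner ℝ x y ≤ ‖y‖ := (real_inner_le_norm x y).trans (by nlinarith)
        have hq : ‖y‖⁻¹ * inner ℝ x y ≤ 1 := by
          rw [inv_mul_le_iff₀ hy0, mul_one]; exact hp
        have hpq : inner ℝ x y = ‖y‖ * (‖y‖⁻¹ * inner ℝ x y) := by field_simp
        generalize ‖y‖⁻¹ * inner ℝ x y = q at *
        rw [hpq]
        nlinarith [mul_nonneg (sub_nonneg.2 hy.le) (sub_nonneg.2 hq)]
      have hH : ∀ x y, ‖H x - H y‖ ≤ K * ‖x - y‖ := by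
        intro x y
        by_cases hx : ‖x‖ ≤ 1 <;> by_cases hy : ‖y‖ ≤ 1
        · simpa [H, hx, hy] using hK' x y hx hy
        · simpa [H, hx, hy] using hmix x y hx (not_le.1 hy)
        · simpa [H, hx, hy, norm_sub_rev] using hmix y x hy (not_le.1 hx)
        · simp only [H, hx, hy, if_false, sub_zero, norm_zero]; positivity
      have hcontr : ContractingWith (t.toNNReal * K) (fun y => w - t • H y) := by
        refine ⟨?_, LipschitzWith.of_dist_le_mul fun x y => ?_⟩
        · rw [← NNReal.coe_lt_coe]; simpa [ht0.le] using htK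
        · rw [dist_eq_norm, dist_eq_norm]
          have : w - t • H x - (w - t • H y) = -(t • (H x - H y)) := by module
          rw [this, norm_neg, norm_smul, Real.norm_of_nonneg ht0.le, NNReal.coe_mul,
            Real.coe_toNNReal _ ht0.le, mul_assoc]
          gcongr
          exact hH x y
      obtain ⟨y, hy⟩ : ∃ y, w - t • H y = y := ⟨_, hcontr.fixedPoint_isFixedPt⟩
      by_cases hy1 : ‖y‖ ≤ 1
      · refine ⟨y, (memB y).2 hy1, ?_⟩
        simp only [H, hy1, if_true] at hy
        simp only
        nth_rewrite 1 [← hy]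
        abel
      · simp only [H, hy1, if_false, smul_zero, sub_zero] at hy
        exact absurd ((memB w).1 hw) (hy ▸ hy1)
  have hderiv : ∀ t : ℝ, ∀ y, HasFDerivAt (fun y => y + t • (r y - y))
      (ContinuousLinearMap.id ℝ E + t • D y) y := fun t y =>
    (hasFDerivAt_id y).add
      (((hr.differentiable one_ne_zero y).hasFDerivAt.sub (hasFDerivAt_id y)).const_smul t)
  have hint : ∀ t, IntegrableOn (J t) B volume := fun t =>
    (hJ.comp (Continuous.prodMk_right t)).continuousOn.integrableOn_compact hB
  have hev : ∀ᶠ t in nhds (0:ℝ), 0 < t → ∫ y in B, J t y = volume.real B := by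
    have e1 : ∀ᶠ t in nhds (0:ℝ), t < 1 := gt_mem_nhds one_pos
    have e2 : ∀ᶠ t in nhds (0:ℝ), t * (K : ℝ) < 1 := by
      refine (continuous_id.mul continuous_const).continuousAt.eventually (gt_mem_nhds ?_)
      simp
    filter_upwards [e1, e2, hpos] with t h1 h2 h3 h0
    obtain ⟨hinj, him⟩ := himage t h0 h1 h2
    have h4 := integral_image_eq_integral_abs_det_fderiv_smul volume hB.measurableSet
      (fun y _ => (hderiv t y).hasFDerivWithinAt) hinj (fun _ => (1:ℝ))
    rw [him] at h4
    simp only [smul_eq_mul, mul_one, integral_const, MeasurableSet.univ, measureReal_restrict_apply,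
      Set.univ_inter] at h4
    rw [h4]
    refine setIntegral_congr_fun hB.measurableSet fun y hy => ?_
    exact (abs_of_pos (h3 y hy)).symm
  obtain ⟨ε, hε, hball⟩ := Metric.eventually_nhds_iff.1 hev
  obtain ⟨s, hsub, hcard⟩ := (Set.Ioo_infinite hε).exists_subset_card_eq (Module.finrank ℝ E + 1)
  have hsJ : ∀ i ∈ s, ∫ y in B, J i y = volume.real B := by
    intro i hi
    have := hsub hi
    refine hball ?_ this.1
    rw [Real.dist_eq, sub_zero, abs_of_pos this.1]
    exact this.2
  have hne : s.Nonempty := Finset.card_pos.1 (by omega)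
  have key : ∫ y in B, J 1 y = volume.real B := by
    have e : ∀ y, J 1 y = ∑ i ∈ s, J i y * (Lagrange.basis s id i).eval 1 := fun y =>
      det_one_add_smul_eq_sum s (by omega) (D y) 1
    simp only [e]
    rw [integral_finsetSum _ fun i _ => (hint i).mul_const _]
    simp only [integral_mul_const]
    rw [Finset.sum_congr rfl fun i hi => by rw [hsJ i hi], ← Finset.mul_sum,
      ← Polynomial.eval_finsetSum, Lagrange.sum_basis Function.injective_id.injOn hne]
    simp
  simp only [hJ1, integral_zero] at key
  have : 0 < volume.real B :=
    ENNReal.toReal_pos (measure_closedBall_pos volume 0 one_pos).ne' hB.measure_lt_top.ne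
  linarith

/-- A `C¹` vector field on a finite-dimensional inner product space takes, at some point,
a nonpositive multiple of the position vector as its value. -/
theorem exists_eq_neg_smul_of_contDiff {E : Type*} [NormedAddCommGroup E]
    [InnerProductSpace ℝ E] [FiniteDimensional ℝ E] {F : E → E} (hF : ContDiff ℝ 1 F) :
    ∃ z, ∃ t : ℝ, 0 ≤ t ∧ F z = -(t • z) := by
  by_contra! hne
  let χ : E → ℝ := fun z => Real.smoothTransition (‖z‖ ^ 2)
  have hχ : ContDiff ℝ 1 χ :=
    (Real.smoothTransition.contDiff (n := 1)).comp (contDiff_norm_sq ℝ)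
  let g : E → E := fun z => (1 - χ z) • F z + χ z • z
  have hg : ContDiff ℝ 1 g := ((contDiff_const.sub hχ).smul hF).add (hχ.smul contDiff_id)
  have hg0 : ∀ z, g z ≠ 0 := by
    intro z hz
    simp only [g] at hz
    have hle : χ z ≤ 1 := Real.smoothTransition.le_one _
    have hnn : 0 ≤ χ z := Real.smoothTransition.nonneg _
    rcases hle.eq_or_lt with h1 | h1
    · have hz0 : z = 0 := by simpa [h1] using hz
      simp [χ, hz0] at h1
    · have h2 : 0 < 1 - χ z := by linarith
      refine hne z ((1 - χ z)⁻¹ * χ z) (by positivity) ?_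
      rw [mul_smul, ← smul_neg, eq_inv_smul_iff₀ h2.ne']
      exact eq_neg_of_add_eq_zero_left hz
  refine not_exists_contDiff_retraction_sphere (r := fun z => ‖g z‖⁻¹ • g z)
    (((hg.norm ℝ hg0).inv fun z => norm_ne_zero_iff.2 (hg0 z)).smul hg) (fun z => ?_)
    fun z hz => ?_
  · rw [norm_smul, norm_inv, norm_norm, inv_mul_cancel₀ (norm_ne_zero_iff.2 (hg0 z))]
  · have : g z = z := by simp [g, χ, hz]
    simp only [this, hz, inv_one, one_smul]

theorem stmt_5 {n m : ℕ} (hmn : m + 1 ≤ n)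
    (A : Fin m → Matrix (Fin n) (Fin n) ℝ) (hA : ∀ i, (A i).IsSymm)
    (h : ∀ x : Fin n → ℝ, x ⬝ᵥ x = 1 → x ⟨n - 1, by omega⟩ < 0 →
        (∀ i : Fin m, x ⬝ᵥ (A i) *ᵥ x = 0) ∨
        (∃ i : Fin m, x ⬝ᵥ (A i) *ᵥ x ≠ 0 ∧
          0 ≤ x (Fin.castLE (by omega) i) * (x ⬝ᵥ (A i) *ᵥ x))) :
    ∃ X : Matrix (Fin n) (Fin n) ℝ, X.PosSemidef ∧ X.rank = 1 ∧
      ∀ i, (A i * X).trace = 0 := by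
  suffices hx : ∃ x : Fin n → ℝ, x ≠ 0 ∧ ∀ i, x ⬝ᵥ (A i) *ᵥ x = 0 by
    obtain ⟨x, hx0, hx⟩ := hx
    refine ⟨vecMulVec x x, ?_, ?_, fun i => ?_⟩
    · simpa using posSemidef_vecMulVec_self_star x
    · refine le_antisymm (rank_vecMulVec_le _ _) (Nat.one_le_iff_ne_zero.2 fun h0 => hx0 ?_)
      rw [Matrix.rank, Submodule.finrank_eq_zero, LinearMap.range_eq_bot] at h0
      simpa [vecMulVec_mulVec] using congrArg (fun L => L x) h0
    · rw [mul_vecMulVec, trace_vecMulVec, dotProduct_comm]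
      exact hx i
  let ι : EuclideanSpace ℝ (Fin m) → Fin n → ℝ := fun z j =>
    if hj : (j : ℕ) < m then z ⟨j, hj⟩ else if (j : ℕ) = n - 1 then -1 else 0
  have hlast : ∀ z, ι z ⟨n - 1, by omega⟩ = -1 := fun z => by
    simp only [ι]; rw [dif_neg (by omega), if_pos trivial]
  have hcast : ∀ z (i : Fin m), ι z (Fin.castLE (by omega) i) = z i := fun z i => by
    simp [ι]
  have hι : ∀ j, ContDiff ℝ 1 (fun z => ι z j) := by
    intro j
    by_cases hj : (j : ℕ) < m
    · simp only [ι, hj, dif_pos]; fun_prop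
    · simp only [ι, hj, dif_neg, not_false_iff]; exact contDiff_const
  let F : EuclideanSpace ℝ (Fin m) → EuclideanSpace ℝ (Fin m) := fun z =>
    WithLp.toLp 2 fun i => ι z ⬝ᵥ (A i) *ᵥ ι z
  have hF : ContDiff ℝ 1 F := by
    rw [contDiff_euclidean]
    intro i
    simp only [F, dotProduct, mulVec]
    exact ContDiff.sum fun j _ => (hι j).mul (ContDiff.sum fun k _ => contDiff_const.mul (hι k))
  obtain ⟨z, t, ht, hz⟩ := exists_eq_neg_smul_of_contDiff hF
  have hzi : ∀ i, ι z ⬝ᵥ (A i) *ᵥ ι z = -(t * z i) := fun i => by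
    simpa [F] using congrArg (fun v : EuclideanSpace ℝ (Fin m) => v i) hz
  have hne : ι z ≠ 0 := fun h0 => by
    have := hlast z
    rw [h0] at this
    norm_num at this
  refine ⟨ι z, hne, ?_⟩
  have hpos : 0 < ι z ⬝ᵥ ι z := by simpa using dotProduct_star_self_pos_iff.2 hne
  let c : ℝ := (√(ι z ⬝ᵥ ι z))⁻¹
  have hc : 0 < c := inv_pos.2 (Real.sqrt_pos.2 hpos)
  have hcc : c * (c * (ι z ⬝ᵥ ι z)) = 1 := by
    have := Real.mul_self_sqrt hpos.le
    simp only [c]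
    nth_rewrite 3 [← this]
    have := (Real.sqrt_pos.2 hpos).ne'
    field_simp
  have hq : ∀ i, (c • ι z) ⬝ᵥ (A i) *ᵥ (c • ι z) = c * (c * (-(t * z i))) := fun i => by
    rw [mulVec_smul, smul_dotProduct, dotProduct_smul, hzi, smul_eq_mul, smul_eq_mul]
  rcases h (c • ι z) (by rw [smul_dotProduct, dotProduct_smul, smul_eq_mul, smul_eq_mul, hcc])
    (by rw [Pi.smul_apply, hlast, smul_eq_mul]; linarith) with h0 | ⟨i, hi0, hi⟩
  · intro i
    have := h0 i
    rw [hq] at this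
    rw [hzi]
    simpa [hc.ne'] using this
  · exfalso
    rw [hq] at hi0 hi
    rw [Pi.smul_apply, hcast, smul_eq_mul] at hi
    have h1 : t * z i ≠ 0 := fun h1 => hi0 (by rw [h1]; simp)
    have h2 : 0 < t := ht.lt_of_ne' (left_ne_zero_of_mul h1)
    have h3 : 0 < z i ^ 2 := by have := right_ne_zero_of_mul h1; positivity
    have h4 : 0 < c ^ 3 * (t * z i ^ 2) := by positivity
    nlinarith
end

section
/- Let m ≤ n − 1 and let A_1,…,A_m be real symmetric n×n matrices. Suppose that for every nonzero x ∈ ℝⁿ, either xᵀ A_i x = 0 for all i = 1,…,m, or there exists an index i ∈ {1,…,m} with xᵀ A_i x ≠ 0 and x_i (xᵀ A_i x) ≥ 0. Then the system ⟨A_i, X⟩ = 0 for i = 1,…,m, X positive semidefinite, has a rank-one solution. -/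
open Matrix

open Metric in
/-- A Lipschitz perturbation of the identity supported in the closed unit ball maps the open unit
ball bijectively onto itself, provided that the Lipschitz constant is less than one. -/
theorem LipschitzWith.injective_and_image_ball_add {E : Type*} [NormedAddCommGroup E]
    [CompleteSpace E] {K : NNReal} {g : E → E} (hg : LipschitzWith K g) (hK : K < 1)
    (h0 : ∀ x, 1 ≤ ‖x‖ → g x = 0) :
    Function.Injective (fun x => x + g x) ∧ (fun x => x + g x) '' ball 0 1 = ball 0 1 := by
  have hinj : Function.Injective (fun x => x + g x) := by
    intro x y hxy
    have h1 : g y - g x = x - y := by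
      simp only at hxy
      rw [sub_eq_sub_iff_add_eq_add, add_comm, ← hxy, add_comm]
    have h2 := hg.norm_sub_le y x
    rw [h1, norm_sub_rev y x] at h2
    have hK' : (K : ℝ) < 1 := by exact_mod_cast hK
    have : ‖x - y‖ ≤ 0 := by nlinarith [norm_nonneg (x - y)]
    exact sub_eq_zero.1 (norm_le_zero_iff.1 this)
  refine ⟨hinj, Set.Subset.antisymm ?_ ?_⟩
  · rintro _ ⟨x, hx, rfl⟩
    rw [mem_ball_zero_iff] at hx ⊢
    by_contra! hy
    have : x = x + g x := hinj (by simp only [h0 _ hy, add_zero])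
    rw [← this] at hy
    exact hx.not_ge hy
  · intro y hy
    have hc : ContractingWith K (fun x => y - g x) := by
      refine ⟨hK, LipschitzWith.of_dist_le_mul fun a b => ?_⟩
      rw [dist_sub_left]
      exact hg.dist_le_mul a b
    have hx := hc.fixedPoint_isFixedPt
    set x := hc.fixedPoint
    have hx' : x + g x = y := by
      rw [Function.IsFixedPt] at hx
      nth_rewrite 1 [← hx]
      abel
    refine ⟨x, ?_, hx'⟩
    rw [mem_ball_zero_iff] at hy ⊢
    by_contra! hge
    rw [h0 x hge, add_zero] at hx'
    rw [hx'] at hge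
    exact hy.not_ge hge

open Metric in
/-- The extension by zero of a function that is Lipschitz on the closed unit ball and vanishes on
the unit sphere is Lipschitz. -/
theorem LipschitzOnWith.lipschitzWith_indicator_closedBall {E F : Type*} [NormedAddCommGroup E]
    [NormedSpace ℝ E] [NormedAddCommGroup F] {K : NNReal} {g : E → F}
    (hg : LipschitzOnWith K g (closedBall 0 1)) (h0 : ∀ x, ‖x‖ = 1 → g x = 0) :
    LipschitzWith K ((closedBall (0 : E) 1).indicator g) := by
  have key : ∀ x y : E, ‖x‖ ≤ 1 → 1 < ‖y‖ → ‖g x‖ ≤ K * dist x y := by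
    intro x y hx hy
    obtain ⟨s, hs, hsz⟩ : ∃ s ∈ Set.Icc (0 : ℝ) 1, ‖AffineMap.lineMap x y s‖ = 1 := by
      have hcont : ContinuousOn (fun s : ℝ => ‖AffineMap.lineMap x y s‖) (Set.Icc 0 1) :=
        (AffineMap.lineMap_continuous.norm).continuousOn
      exact intermediate_value_Icc zero_le_one hcont (by simp [hx, hy.le])
    have h1 := hg.dist_le_mul x (by simpa using hx) (AffineMap.lineMap x y s)
      (by simp [hsz])
    rw [h0 _ hsz, dist_zero_right, dist_left_lineMap] at h1
    refine h1.trans ?_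
    gcongr
    rw [Real.norm_of_nonneg hs.1]
    exact mul_le_of_le_one_left dist_nonneg hs.2
  refine LipschitzWith.of_dist_le_mul fun x y => ?_
  by_cases hx : ‖x‖ ≤ 1 <;> by_cases hy : ‖y‖ ≤ 1
  · simpa [Set.indicator, hx, hy] using
      hg.dist_le_mul x (by simpa using hx) y (by simpa using hy)
  · simpa [Set.indicator, hx, hy] using key x y hx (not_le.1 hy)
  · simpa [Set.indicator, hx, hy, dist_comm] using key y x hy (not_le.1 hx)
  · simp only [Set.indicator, mem_closedBall_zero_iff, hx, hy, if_false, dist_self]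
    positivity

/-- If `‖B‖ < 1` then `1 + B` has positive determinant. -/
theorem ContinuousLinearMap.det_one_add_pos {E : Type*} [NormedAddCommGroup E] [NormedSpace ℝ E]
    {B : E →L[ℝ] E} (hB : ‖B‖ < 1) : 0 < (1 + B).det := by
  have hne : ∀ s ∈ Set.Icc (0 : ℝ) 1, (1 + s • B).det ≠ 0 := by
    intro s hs hdet
    obtain ⟨v, hv, hv0⟩ := Submodule.exists_mem_ne_zero_of_ne_bot
      (LinearMap.bot_lt_ker_of_det_eq_zero hdet).ne'
    have h1 : v + s • B v = 0 := by simpa using hv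
    have h2 : ‖v‖ = s * ‖B v‖ := by
      rw [eq_neg_of_add_eq_zero_left h1, norm_neg, norm_smul, Real.norm_of_nonneg hs.1]
      simp [← eq_neg_of_add_eq_zero_left h1]
    have h3 := B.le_opNorm v
    have h4 := norm_pos_iff.2 hv0
    nlinarith [hs.1, hs.2, norm_nonneg (B v)]
  have hcont : ContinuousOn (fun s : ℝ => (1 + s • B).det) (Set.Icc 0 1) :=
    (ContinuousLinearMap.continuous_det.comp (by fun_prop)).continuousOn
  by_contra! hle
  obtain ⟨s, hs, h0⟩ := intermediate_value_Icc' zero_le_one hcont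
    (show (0 : ℝ) ∈ _ by simpa [ContinuousLinearMap.det] using hle)
  exact hne s hs h0

/-- Since `det (1 + t • A)` is a polynomial in `t`, its value at `t = 1` is a universal affine
combination of its values at small positive `t`. -/
theorem ContinuousLinearMap.exists_det_one_add_eq_sum {E : Type*} [NormedAddCommGroup E]
    [NormedSpace ℝ E] [FiniteDimensional ℝ E] {δ : ℝ} (hδ : 0 < δ) :
    ∃ (s : Finset ℝ) (c : ℝ → ℝ), (∀ t ∈ s, 0 < t ∧ t < δ) ∧ ∑ t ∈ s, c t = 1 ∧
      ∀ A : E →L[ℝ] E, (1 + A).det = ∑ t ∈ s, c t * (1 + t • A).det := by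
  obtain ⟨s, hs, hcard⟩ := (Set.Ioo_infinite hδ).exists_subset_card_eq (Module.finrank ℝ E + 1)
  have hinj : Set.InjOn (id : ℝ → ℝ) s := Function.injective_id.injOn
  have hne : s.Nonempty := Finset.card_pos.1 (by omega)
  refine ⟨s, fun t => (Lagrange.basis s id t).eval 1, fun t ht => hs ht, ?_, fun A => ?_⟩
  · rw [← Polynomial.eval_finsetSum, Lagrange.sum_basis hinj hne, Polynomial.eval_one]
  · let b := Module.finBasis ℝ E
    let M := LinearMap.toMatrix b b (A : E →ₗ[ℝ] E)
    let p : Polynomial ℝ := ((Polynomial.X : Polynomial ℝ) • M.map Polynomial.C +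
      (1 : Matrix (Fin (Module.finrank ℝ E)) (Fin (Module.finrank ℝ E)) ℝ).map Polynomial.C).det
    have hp : ∀ t, p.eval t = (1 + t • A).det := by
      intro t
      rw [ContinuousLinearMap.det, ← LinearMap.det_toMatrix b]
      have h1 : LinearMap.toMatrix b b ((1 + t • A : E →L[ℝ] E) : E →ₗ[ℝ] E) = t • M + 1 := by
        have h2 : ((1 + t • A : E →L[ℝ] E) : E →ₗ[ℝ] E) = t • (A : E →ₗ[ℝ] E) + 1 :=
          LinearMap.ext fun x => add_comm _ _
        rw [h2, map_add, map_smul, LinearMap.toMatrix_one]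
      rw [h1, ← Polynomial.coe_evalRingHom, RingHom.map_det]
      congr 1
      ext i j
      rcases eq_or_ne i j with rfl | hij
      · simp
        ring
      · simp [hij]
        ring
    have hdeg : p.degree < s.card := by
      refine Polynomial.degree_le_natDegree.trans_lt ?_
      have := Polynomial.natDegree_det_X_add_C_le M 1
      rw [Fintype.card_fin] at this
      rw [hcard]
      exact_mod_cast Nat.lt_succ_of_le this
    have h1 := congrArg (Polynomial.eval 1) (Lagrange.eq_interpolate hinj hdeg)
    rw [Lagrange.interpolate_apply, Polynomial.eval_finsetSum, hp, one_smul] at h1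
    simpa [hp, mul_comm] using h1

open MeasureTheory Metric in
/-- There is no continuously differentiable retraction of the closed unit ball onto the unit
sphere. -/
theorem not_exists_contDiff_retraction_sphere_s6 {E : Type*} [NormedAddCommGroup E]
    [InnerProductSpace ℝ E] [FiniteDimensional ℝ E] {r : E → E}
    (hr : ∀ x ∈ closedBall (0 : E) 1, ContDiffAt ℝ 1 r x)
    (hid : ∀ x, ‖x‖ = 1 → r x = x) : ¬ ∀ x ∈ closedBall (0 : E) 1, ‖r x‖ = 1 := by
  intro hnorm
  borelize E
  let g : E → E := fun x => r x - x
  have hg : ∀ x ∈ closedBall (0 : E) 1, ContDiffAt ℝ 1 g x := fun x hx =>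
    (hr x hx).sub contDiffAt_id
  obtain ⟨K, hK⟩ := ContDiffOn.exists_lipschitzOnWith (n := 1)
    (fun x hx => (hg x hx).contDiffWithinAt) one_ne_zero (convex_closedBall (0 : E) 1)
    (isCompact_closedBall 0 1)
  let G := (closedBall (0 : E) 1).indicator g
  have hG : LipschitzWith K G := hK.lipschitzWith_indicator_closedBall fun x hx => by
    simp [g, hid x hx]
  have hG0 : ∀ x, 1 ≤ ‖x‖ → G x = 0 := by
    intro x hx
    rcases hx.eq_or_lt with h | h
    · simp [G, g, hid x h.symm]
    · simp [G, not_le.2 h]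
  have hGd : ∀ x ∈ ball (0 : E) 1, HasFDerivAt G (fderiv ℝ g x) x := by
    intro x hx
    refine ((hg x (ball_subset_closedBall hx)).differentiableAt one_ne_zero).hasFDerivAt
      |>.congr_of_eventuallyEq ?_
    filter_upwards [isOpen_ball.mem_nhds hx] with y hy
    exact Set.indicator_of_mem (ball_subset_closedBall hy) g
  have hvol : ∀ t : ℝ, 0 < t → t < 1 / (K + 1) →
      ∫ x in ball (0 : E) 1, (1 + t • fderiv ℝ g x).det = volume.real (ball (0 : E) 1) := by
    intro t ht htK
    rw [lt_div_iff₀ (by positivity)] at htK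
    have hlip : LipschitzWith (t.toNNReal * K) (fun x => t • G x) := by
      refine LipschitzWith.of_dist_le_mul fun a b => ?_
      rw [dist_smul₀, Real.norm_of_nonneg ht.le, NNReal.coe_mul, Real.coe_toNNReal _ ht.le,
        mul_assoc]
      exact mul_le_mul_of_nonneg_left (hG.dist_le_mul a b) ht.le
    have hlt : t.toNNReal * K < 1 := by
      rw [← NNReal.coe_lt_coe, NNReal.coe_mul, Real.coe_toNNReal _ ht.le]
      push_cast
      linarith
    obtain ⟨hinj, himg⟩ := hlip.injective_and_image_ball_add hlt fun x hx => by simp [hG0 x hx]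
    have h1 := integral_image_eq_integral_abs_det_fderiv_smul (volume : Measure E)
      (measurableSet_ball (x := (0 : E)) (ε := 1))
      (fun x hx => ((hasFDerivAt_id x).add ((hGd x hx).const_smul t)).hasFDerivWithinAt)
      hinj.injOn (fun _ => (1 : ℝ))
    have himg' : (id + t • G) '' ball 0 1 = ball (0 : E) 1 := himg
    rw [himg'] at h1
    simp only [integral_const, smul_eq_mul, mul_one, measureReal_restrict_apply_univ] at h1
    rw [h1]
    refine setIntegral_congr_fun measurableSet_ball fun x hx => ?_
    refine (abs_of_pos (ContinuousLinearMap.det_one_add_pos ?_)).symm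
    have h2 : ‖fderiv ℝ g x‖ ≤ K := by
      rw [← (hGd x hx).fderiv]
      exact norm_fderiv_le_of_lipschitz ℝ hG
    rw [norm_smul, Real.norm_of_nonneg ht.le]
    nlinarith
  have hint : ∀ t : ℝ, IntegrableOn (fun x => (1 + t • fderiv ℝ g x).det) (ball (0 : E) 1) := by
    intro t
    refine IntegrableOn.mono_set (ContinuousOn.integrableOn_compact
      (isCompact_closedBall (0 : E) 1) ?_) ball_subset_closedBall
    refine ContinuousLinearMap.continuous_det.comp_continuousOn ?_
    have hc : ContinuousOn (fderiv ℝ g) (closedBall 0 1) := fun x hx =>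
      ((hg x hx).continuousAt_fderiv one_ne_zero).continuousWithinAt
    fun_prop
  have hzero : ∀ x ∈ ball (0 : E) 1, (1 + fderiv ℝ g x).det = 0 := by
    intro x hx
    have hx' := ball_subset_closedBall hx
    have hrd := (hr x hx').differentiableAt one_ne_zero
    have h1 : 1 + fderiv ℝ g x = fderiv ℝ r x := by
      rw [show fderiv ℝ g x = fderiv ℝ r x - 1 from
        (hrd.hasFDerivAt.sub (hasFDerivAt_id x)).fderiv]
      abel
    rw [h1]
    by_contra hdet
    have hsurj : Function.Surjective (fderiv ℝ r x) :=
      (LinearMap.equivOfDetNeZero _ hdet).surjective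
    obtain ⟨v, hv⟩ := hsurj (r x)
    have h2 := hrd.hasFDerivAt.norm_sq
    have h3 : HasFDerivAt (fun y => ‖r y‖ ^ 2) (0 : E →L[ℝ] ℝ) x := by
      refine (hasFDerivAt_const (1 : ℝ) x).congr_of_eventuallyEq ?_
      filter_upwards [isOpen_ball.mem_nhds hx] with y hy
      rw [hnorm y (ball_subset_closedBall hy), one_pow]
    have h4 := congrArg (fun L : E →L[ℝ] ℝ => L v) (h2.unique h3)
    simp [hv, hnorm x hx'] at h4
  obtain ⟨s, c, hs, hc, hdet⟩ := ContinuousLinearMap.exists_det_one_add_eq_sum (E := E)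
    (δ := 1 / ((K : ℝ) + 1)) (by positivity)
  have h1 : ∫ x in ball (0 : E) 1, (1 + fderiv ℝ g x).det = volume.real (ball (0 : E) 1) := by
    simp only [fun x => hdet (fderiv ℝ g x)]
    rw [integral_finsetSum _ fun t _ => (hint t).const_mul _]
    simp_rw [integral_const_mul]
    rw [Finset.sum_congr rfl fun t ht => by rw [hvol t (hs t ht).1 (hs t ht).2],
      ← Finset.sum_mul, hc, one_mul]
  rw [setIntegral_congr_fun measurableSet_ball hzero] at h1
  have h2 : 0 < volume.real (ball (0 : E) 1) :=
    ENNReal.toReal_pos (measure_ball_pos _ _ one_pos).ne' measure_ball_lt_top.ne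
  simp at h1
  linarith

open Metric in
/-- **Poincaré–Bohl theorem** for continuously differentiable maps: a map on the closed unit ball
that never points in the direction opposite to the position on the unit sphere has a zero. -/
theorem exists_eq_zero_of_forall_ne_neg_smul {E : Type*} [NormedAddCommGroup E]
    [InnerProductSpace ℝ E] [FiniteDimensional ℝ E] {f : E → E} (hf : ContDiff ℝ 1 f)
    (h : ∀ x, ‖x‖ = 1 → ∀ a : ℝ, 0 < a → f x ≠ -(a • x)) : ∃ x, ‖x‖ ≤ 1 ∧ f x = 0 := by
  by_contra! hne
  have hfc := hf.continuous
  obtain ⟨a, ha, hN⟩ : ∃ a : ℝ, 0 < a ∧ ∀ x ∈ closedBall (0 : E) 1,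
      (a * (1 - ‖x‖ ^ 2)) • f x + ‖x‖ ^ 2 • x ≠ 0 := by
    let S : Set E := closedBall 0 1 ∩ {x | ‖x‖ • f x = -(‖f x‖ • x)}
    have hS : IsCompact S := (isCompact_closedBall 0 1).inter_right
      (isClosed_eq (by fun_prop) (by fun_prop))
    have hpos : ∀ x ∈ S, 0 < (1 - ‖x‖ ^ 2) * ‖f x‖ := by
      rintro x ⟨hx, hxS⟩
      rw [mem_closedBall_zero_iff] at hx
      have hfx := norm_pos_iff.2 (hne x hx)
      have hx1 : ‖x‖ ≠ 1 := fun h1 => h x h1 _ hfx (by simpa [h1] using hxS)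
      have : ‖x‖ < 1 := lt_of_le_of_ne hx hx1
      have : 0 < 1 - ‖x‖ ^ 2 := by nlinarith [norm_nonneg x]
      positivity
    obtain ⟨c, hc, hcS⟩ : ∃ c : ℝ, 0 < c ∧ ∀ x ∈ S, c ≤ (1 - ‖x‖ ^ 2) * ‖f x‖ :=
      hS.exists_forall_le' (by fun_prop) hpos
    refine ⟨2 / c, by positivity, fun x hx h0 => ?_⟩
    rw [mem_closedBall_zero_iff] at hx
    have hs : 0 ≤ 1 - ‖x‖ ^ 2 := by nlinarith [norm_nonneg x]
    have h1 := eq_neg_of_add_eq_zero_left h0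
    have h2 : 2 / c * (1 - ‖x‖ ^ 2) * ‖f x‖ = ‖x‖ ^ 2 * ‖x‖ := by
      have := congrArg norm h1
      rwa [norm_neg, norm_smul, norm_smul, Real.norm_of_nonneg (by positivity),
        Real.norm_of_nonneg (by positivity)] at this
    have hs' : 1 - ‖x‖ ^ 2 ≠ 0 := by
      intro hs0
      rw [hs0] at h2
      have : ‖x‖ = 0 := by simpa using h2.symm
      norm_num [this] at hs0
    have hxS : x ∈ S := by
      refine ⟨by simpa using hx, ?_⟩
      have hb : 2 / c * (1 - ‖x‖ ^ 2) ≠ 0 := by positivity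
      refine smul_right_injective E hb ?_
      beta_reduce
      rw [smul_comm, h1, smul_neg, smul_neg, smul_smul, smul_smul, h2, mul_comm]
    have h3 := hcS x hxS
    have h4 : 2 ≤ 2 / c * (1 - ‖x‖ ^ 2) * ‖f x‖ := by
      rw [mul_assoc]
      calc (2 : ℝ) = 2 / c * c := by field_simp
        _ ≤ _ := by gcongr
    nlinarith [norm_nonneg x, mul_nonneg (norm_nonneg x) hs]
  let N : E → E := fun x => (a * (1 - ‖x‖ ^ 2)) • f x + ‖x‖ ^ 2 • x
  have hNd : ContDiff ℝ 1 N := by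
    have := contDiff_norm_sq ℝ (E := E) (n := 1)
    fun_prop
  refine not_exists_contDiff_retraction_sphere_s6 (r := fun x => ‖N x‖⁻¹ • N x)
    (fun x hx => ?_) (fun x hx => ?_) fun x hx => ?_
  · exact ((hNd.contDiffAt.norm ℝ (hN x hx)).inv (norm_ne_zero_iff.2 (hN x hx))).smul
      hNd.contDiffAt
  · simp [N, hx]
  · rw [norm_smul, norm_inv, norm_norm, inv_mul_cancel₀ (norm_ne_zero_iff.2 (hN x hx))]

theorem stmt_6 {n m : ℕ} (hmn : m + 1 ≤ n)
    (A : Fin m → Matrix (Fin n) (Fin n) ℝ) (hA : ∀ i, (A i).IsSymm)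
    (h : ∀ x : Fin n → ℝ, x ≠ 0 →
        (∀ i : Fin m, x ⬝ᵥ (A i) *ᵥ x = 0) ∨
        (∃ i : Fin m, x ⬝ᵥ (A i) *ᵥ x ≠ 0 ∧
          0 ≤ x (Fin.castLE (by omega) i) * (x ⬝ᵥ (A i) *ᵥ x))) :
    ∃ X : Matrix (Fin n) (Fin n) ℝ, X.PosSemidef ∧ X.rank = 1 ∧
      ∀ i, (A i * X).trace = 0 := by
  let v : EuclideanSpace ℝ (Fin m) → Fin n → ℝ := fun x j =>
    if hj : (j : ℕ) < m then x ⟨j, hj⟩ else if (j : ℕ) = m then 1 - ‖x‖ ^ 2 else 0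
  have hv_coord : ∀ x (i : Fin m), v x (Fin.castLE (by omega) i) = x i := by
    intro x i
    simp [v]
  have hv_ne : ∀ x, v x ≠ 0 := by
    intro x hx
    have hx0 : x = 0 := by
      ext i
      rw [← hv_coord, hx]
      rfl
    have := congrFun hx ⟨m, hmn⟩
    simp [v, hx0] at this
  have hv_diff : ∀ j, ContDiff ℝ 1 (fun x => v x j) := by
    intro j
    have := contDiff_norm_sq ℝ (E := EuclideanSpace ℝ (Fin m)) (n := 1)
    simp only [v]
    split_ifs <;> fun_prop
  let f : EuclideanSpace ℝ (Fin m) → EuclideanSpace ℝ (Fin m) := fun x =>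
    WithLp.toLp 2 fun i => v x ⬝ᵥ (A i) *ᵥ v x
  have hf : ContDiff ℝ 1 f := by
    rw [contDiff_euclidean]
    intro i
    simp only [f, dotProduct, mulVec]
    fun_prop
  obtain ⟨x, -, hx⟩ := exists_eq_zero_of_forall_ne_neg_smul hf (by
    intro x hx a ha hfx
    have hfi : ∀ i, v x ⬝ᵥ (A i) *ᵥ v x = -(a * x i) := fun i => by
      simpa [f] using congrArg (fun y : EuclideanSpace ℝ (Fin m) => y i) hfx
    rcases h (v x) (hv_ne x) with h0 | ⟨i, hi, hle⟩
    · have : x = 0 := by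
        ext i
        simpa [hfi, ha.ne'] using h0 i
      simp [this] at hx
    · rw [hv_coord, hfi] at hle
      rw [hfi] at hi
      have : x i ≠ 0 := fun h0 => hi (by simp [h0])
      nlinarith [mul_pos ha (mul_self_pos.2 this)])
  have hq : ∀ i, v x ⬝ᵥ (A i) *ᵥ v x = 0 := fun i => by
    simpa [f] using congrArg (fun y : EuclideanSpace ℝ (Fin m) => y i) hx
  refine ⟨vecMulVec (v x) (v x), ?_, ?_, fun i => ?_⟩
  · simpa using posSemidef_vecMulVec_self_star (v x)
  · refine le_antisymm (rank_vecMulVec_le _ _) (Nat.one_le_iff_ne_zero.2 fun h0 => hv_ne x ?_)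
    rw [rank, Submodule.finrank_eq_zero] at h0
    have h1 : vecMulVec (v x) (v x) *ᵥ v x = 0 := by
      rw [← mulVecLin_apply, LinearMap.range_eq_bot.1 h0, LinearMap.zero_apply]
    have h2 := congrArg (v x ⬝ᵥ ·) h1
    simpa [vecMulVec_mulVec, dotProduct_smul] using h2
  · rw [mul_vecMulVec, trace_vecMulVec, dotProduct_comm, hq]
end

section
/- Let A_1,…,A_m be real symmetric n×n matrices. There exist t_1,…,t_m ∈ ℝ such that ∑_{i=1}^m t_i A_i is positive definite if and only if X = 0 is the only positive semidefinite matrix X satisfying ⟨A_i, X⟩ = 0 for all i = 1,…,m. Equivalently, ∑_{i=1}^m t_i A_i is not positive definite for every choice of t_1,…,t_m ∈ ℝ if and only if the system has a solution X with rank(X) ≥ 1. -/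
open Matrix

namespace Matrix

open scoped MatrixOrder

variable {ι : Type*} [Fintype ι]

/-- Every positive semidefinite real matrix is a Gram matrix. -/
lemma PosSemidef.exists_eq_transpose_mul_self {X : Matrix ι ι ℝ} (hX : X.PosSemidef) :
    ∃ B : Matrix ι ι ℝ, X = Bᵀ * B := by
  classical
  obtain ⟨B, hB⟩ := CStarAlgebra.nonneg_iff_eq_star_mul_self.mp hX.nonneg
  exact ⟨B, by rw [hB, star_eq_conjTranspose, conjTranspose_eq_transpose_of_trivial]⟩

lemma posSemidef_transpose_mul_self (B : Matrix ι ι ℝ) : (Bᵀ * B).PosSemidef := by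
  simpa using posSemidef_conjTranspose_mul_self B

lemma rank_eq_zero_iff_eq_zero (X : Matrix ι ι ℝ) : X.rank = 0 ↔ X = 0 := by
  classical
  rw [rank, Submodule.finrank_eq_zero, LinearMap.range_eq_bot, ← toLin'_apply', map_eq_zero_iff _
    toLin'.injective]

/-- The trace pairing of a positive definite matrix with a positive semidefinite matrix vanishes
only when the latter does. -/
lemma PosDef.eq_zero_of_trace_mul_eq_zero {P X : Matrix ι ι ℝ} (hP : P.PosDef)
    (hX : X.PosSemidef) (h : (P * X).trace = 0) : X = 0 := by
  obtain ⟨B, rfl⟩ := hX.exists_eq_transpose_mul_self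
  have hBP : (B * P * Bᵀ).PosSemidef := by
    simpa using hP.posSemidef.mul_mul_conjTranspose_same B
  have hzero : B * P * Bᵀ = 0 := by
    rw [← hBP.trace_eq_zero_iff, trace_mul_comm, ← Matrix.mul_assoc, trace_mul_comm, ← h]
  have hB : B = 0 := by
    ext i j
    by_contra hij
    have hrow : B i ≠ 0 := fun h0 => hij (congrFun h0 j)
    have hpos := hP.dotProduct_mulVec_pos hrow
    have hi : (B * P * Bᵀ) i i = 0 := by rw [hzero]; rfl
    rw [Matrix.mul_assoc, mul_apply] at hi
    exact hpos.ne' hi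
  simp [hB]

/-- The set of density matrices is compact. -/
lemma isCompact_posSemidef_trace_eq_one :
    IsCompact {X : Matrix ι ι ℝ | X.PosSemidef ∧ X.trace = 1} := by
  have hcont : Continuous fun B : Matrix ι ι ℝ => Bᵀ * B := by fun_prop
  have hS : IsCompact {B : Matrix ι ι ℝ | (Bᵀ * B).trace = 1} := by
    have hbox : IsCompact (Set.univ.pi fun _ : ι => Set.univ.pi fun _ : ι => Set.Icc (-1 : ℝ) 1) :=
      isCompact_univ_pi fun _ => isCompact_univ_pi fun _ => isCompact_Icc
    refine hbox.of_isClosed_subset (isClosed_eq hcont.matrix_trace continuous_const) ?_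
    intro B hB i _ j _
    have hsum : ∑ j, ∑ i, B i j * B i j = 1 := hB
    have hle : B i j * B i j ≤ 1 := by
      rw [← hsum]
      exact (Finset.single_le_sum (f := fun i => B i j * B i j)
        (fun _ _ => mul_self_nonneg _) (Finset.mem_univ i)).trans
        (Finset.single_le_sum (f := fun j => ∑ i, B i j * B i j)
        (fun _ _ => Finset.sum_nonneg fun _ _ => mul_self_nonneg _) (Finset.mem_univ j))
    exact ⟨by nlinarith, by nlinarith⟩
  convert hS.image hcont using 1
  ext X
  constructor
  · rintro ⟨hX, htr⟩
    obtain ⟨B, rfl⟩ := hX.exists_eq_transpose_mul_self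
    exact ⟨B, htr, rfl⟩
  · rintro ⟨B, hB, rfl⟩
    exact ⟨posSemidef_transpose_mul_self B, hB⟩

lemma convex_posSemidef_trace_eq_one :
    Convex ℝ {X : Matrix ι ι ℝ | X.PosSemidef ∧ X.trace = 1} := by
  rintro X ⟨hX, hX1⟩ Y ⟨hY, hY1⟩ a b ha hb hab
  exact ⟨(hX.smul ha).add (hY.smul hb), by simp [hX1, hY1, hab]⟩

/-- If no density matrix is orthogonal to all the `A i`, some linear combination of the `A i` is
positive definite. -/
lemma exists_posDef_sum_smul {κ : Type*} [Fintype κ] (A : κ → Matrix ι ι ℝ)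
    (hA : ∀ i, (A i).IsSymm)
    (h : ∀ X : Matrix ι ι ℝ, X.PosSemidef → (∀ i, (A i * X).trace = 0) → X = 0) :
    ∃ t : κ → ℝ, (∑ i, t i • A i).PosDef := by
  classical
  let L : Matrix ι ι ℝ →ₗ[ℝ] κ → ℝ :=
    LinearMap.pi fun i => (traceLinearMap ι ℝ ℝ).comp (LinearMap.mulLeft ℝ (A i))
  have hL : ∀ X i, L X i = (A i * X).trace := fun _ _ => rfl
  have hLc : Continuous L := continuous_pi fun i =>
    (continuous_const.matrix_mul continuous_id).matrix_trace
  have h0 : (0 : κ → ℝ) ∉ L '' {X | X.PosSemidef ∧ X.trace = 1} := by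
    rintro ⟨X, ⟨hX, hX1⟩, hLX⟩
    have := h X hX fun i => by rw [← hL, hLX]; rfl
    simp [this] at hX1
  obtain ⟨f, u, hu, hf⟩ := geometric_hahn_banach_point_closed
    (convex_posSemidef_trace_eq_one.linear_image L)
    (isCompact_posSemidef_trace_eq_one.image hLc).isClosed h0
  rw [map_zero] at hu
  refine ⟨fun i => f (Pi.single i 1), .of_dotProduct_mulVec_pos ?_ fun x hx => ?_⟩
  · simp only [IsHermitian, conjTranspose_eq_transpose_of_trivial, transpose_sum, transpose_smul]
    exact Finset.sum_congr rfl fun i _ => by rw [(hA i).eq]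
  · have hxx : 0 < x ⬝ᵥ x := by simpa using dotProduct_star_self_pos_iff.mpr hx
    have hmem : (x ⬝ᵥ x)⁻¹ • vecMulVec x x ∈ {X : Matrix ι ι ℝ | X.PosSemidef ∧ X.trace = 1} := by
      refine ⟨.smul (by simpa using posSemidef_vecMulVec_self_star x) (inv_nonneg.mpr hxx.le), ?_⟩
      rw [trace_smul, trace_vecMulVec, smul_eq_mul, inv_mul_cancel₀ hxx.ne']
    have hpos := hu.trans (hf _ (Set.mem_image_of_mem L hmem))
    rw [map_smul, map_smul, smul_eq_mul] at hpos
    have hquad := pos_of_mul_pos_right hpos (inv_nonneg.mpr hxx.le)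
    convert hquad using 1
    rw [pi_eq_sum_univ' (L (vecMulVec x x)), map_sum, sum_mulVec, dotProduct_sum]
    refine Finset.sum_congr rfl fun i _ => ?_
    rw [map_smul, hL, mul_vecMulVec, trace_vecMulVec, smul_mulVec, dotProduct_smul, smul_eq_mul,
      smul_eq_mul, mul_comm, star_trivial, dotProduct_comm]

end Matrix

theorem stmt_8 {n m : ℕ}
    (A : Fin m → Matrix (Fin n) (Fin n) ℝ) (hA : ∀ i, (A i).IsSymm) :
    ((∃ t : Fin m → ℝ, (∑ i, t i • A i).PosDef) ↔
      (∀ X : Matrix (Fin n) (Fin n) ℝ,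
        X.PosSemidef → (∀ i, (A i * X).trace = 0) → X = 0)) ∧
    ((∀ t : Fin m → ℝ, ¬ (∑ i, t i • A i).PosDef) ↔
      (∃ X : Matrix (Fin n) (Fin n) ℝ,
        X.PosSemidef ∧ (∀ i, (A i * X).trace = 0) ∧ 1 ≤ X.rank)) := by
  have key : (∃ t : Fin m → ℝ, (∑ i, t i • A i).PosDef) ↔
      (∀ X : Matrix (Fin n) (Fin n) ℝ,
        X.PosSemidef → (∀ i, (A i * X).trace = 0) → X = 0) := by
    refine ⟨?_, exists_posDef_sum_smul A hA⟩
    rintro ⟨t, ht⟩ X hX hAX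
    refine ht.eq_zero_of_trace_mul_eq_zero hX ?_
    simp [Finset.sum_mul, trace_sum, hAX]
  refine ⟨key, ?_⟩
  rw [← not_exists, key]
  push Not
  simp only [Nat.one_le_iff_ne_zero, ne_eq, rank_eq_zero_iff_eq_zero]
end

section
/- Let A_1,…,A_m be real symmetric n×n matrices. Suppose there exist t_1,…,t_m ∈ ℝ with ∑_{i=1}^m t_i A_i positive semidefinite and rank(∑_{i=1}^m t_i A_i) = n − 1, and that for every choice of t_1,…,t_m ∈ ℝ the matrix ∑_{i=1}^m t_i A_i is not positive definite (i.e., the maximum rank r* over positive semidefinite combinations equals n − 1). Then the system ⟨A_i, X⟩ = 0 for i = 1,…,m, X positive semidefinite, has a rank-one solution, and every nonzero positive semidefinite solution X of this system satisfies rank(X) = 1. -/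
open Matrix

/-- Finsler's lemma: if the quadratic form of `C` is positive on the nonzero kernel vectors of a
positive semidefinite `B`, then `s • B + C` is positive definite for some `s`. -/
theorem Matrix.PosSemidef.exists_smul_add_posDef {ι : Type*} [Fintype ι] {B C : Matrix ι ι ℝ}
    (hB : B.PosSemidef) (hC : C.IsHermitian)
    (hpos : ∀ x, x ≠ 0 → B *ᵥ x = 0 → 0 < x ⬝ᵥ C *ᵥ x) :
    ∃ s : ℝ, (s • B + C).PosDef := by
  have hB0 : ∀ x, 0 ≤ x ⬝ᵥ B *ᵥ x := fun x => by simpa using hB.dotProduct_mulVec_nonneg x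
  obtain ⟨k, hk⟩ := (isCompact_sphere (0 : ι → ℝ) 1).elim_directed_cover
    (fun k : ℕ => {x | 0 < k * (x ⬝ᵥ B *ᵥ x) + x ⬝ᵥ C *ᵥ x})
    (fun k => isOpen_lt continuous_const (by fun_prop))
    (by
      intro x hx
      have hx0 : x ≠ 0 := ne_zero_of_mem_unit_sphere ⟨x, hx⟩
      rw [Set.mem_iUnion]
      by_cases hBx : B *ᵥ x = 0
      · exact ⟨0, by simpa using hpos x hx0 hBx⟩
      · have hlt : 0 < x ⬝ᵥ B *ᵥ x := (hB0 x).lt_of_ne' fun h =>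
          hBx ((hB.dotProduct_mulVec_zero_iff x).1 (by simpa using h))
        obtain ⟨k, hk⟩ := exists_nat_gt (-(x ⬝ᵥ C *ᵥ x) / (x ⬝ᵥ B *ᵥ x))
        rw [div_lt_iff₀ hlt] at hk
        exact ⟨k, by simp only [Set.mem_ofPred_eq]; linarith⟩)
    (directed_of_isDirected_le fun i j hij x hx => by
      have : (i : ℝ) * (x ⬝ᵥ B *ᵥ x) ≤ j * (x ⬝ᵥ B *ᵥ x) :=
        mul_le_mul_of_nonneg_right (by exact_mod_cast hij) (hB0 x)
      simp only [Set.mem_ofPred_eq] at hx ⊢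
      linarith)
  have hBk : ((k : ℝ) • B).IsHermitian := (hB.smul k.cast_nonneg).isHermitian
  refine ⟨k, .of_dotProduct_mulVec_pos (hBk.add hC) fun x hx => ?_⟩
  have hnorm : 0 < ‖x‖ := norm_pos_iff.2 hx
  have hunit := hk (show ‖x‖⁻¹ • x ∈ Metric.sphere 0 1 by
    rw [mem_sphere_zero_iff_norm, norm_smul, norm_inv, norm_norm, inv_mul_cancel₀ hnorm.ne'])
  simp only [Set.mem_ofPred_eq, mulVec_smul, smul_dotProduct, dotProduct_smul, smul_eq_mul] at hunit
  simp only [star_trivial, add_mulVec, smul_mulVec, dotProduct_add, dotProduct_smul, smul_eq_mul]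
  refine pos_of_mul_pos_right (a := ‖x‖⁻¹ * ‖x‖⁻¹) ?_ (by positivity)
  linarith

open scoped MatrixOrder in
theorem Matrix.PosSemidef.mul_eq_zero_of_trace_mul_eq_zero {ι : Type*} [Fintype ι]
    {B X : Matrix ι ι ℝ} (hB : B.PosSemidef) (hX : X.PosSemidef) (h : (B * X).trace = 0) :
    B * X = 0 := by
  classical
  obtain ⟨Z, rfl⟩ := CStarAlgebra.nonneg_iff_eq_star_mul_self.mp hB.nonneg
  obtain ⟨Y, rfl⟩ := CStarAlgebra.nonneg_iff_eq_star_mul_self.mp hX.nonneg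
  simp only [star_eq_conjTranspose] at h ⊢
  have hZY : Z * Yᴴ = 0 := by
    rw [← trace_mul_conjTranspose_self_eq_zero_iff, conjTranspose_mul, conjTranspose_conjTranspose,
      ← h, trace_mul_comm, Matrix.mul_assoc, trace_mul_comm]
    simp only [Matrix.mul_assoc]
  rw [Matrix.mul_assoc, ← Matrix.mul_assoc Z, hZY, Matrix.zero_mul, Matrix.mul_zero]

theorem Matrix.rank_pos_of_ne_zero {ι κ K : Type*} [Fintype ι] [Finite κ] [Field K]
    {X : Matrix κ ι K} (hX : X ≠ 0) : 0 < X.rank := by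
  classical
  rw [Nat.pos_iff_ne_zero, Matrix.rank, ne_eq, Submodule.finrank_eq_zero, LinearMap.range_eq_bot]
  exact fun h => hX (ext_of_mulVec_single fun i => by
    rw [← mulVecLin_apply, h, LinearMap.zero_apply, zero_mulVec])

theorem stmt_10 {n m : ℕ}
    (A : Fin m → Matrix (Fin n) (Fin n) ℝ) (hA : ∀ i, (A i).IsSymm)
    (h1 : ∃ t : Fin m → ℝ,
      (∑ i, t i • A i).PosSemidef ∧ (∑ i, t i • A i).rank = n - 1)
    (h2 : ∀ t : Fin m → ℝ, ¬ (∑ i, t i • A i).PosDef) :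
    (∃ X : Matrix (Fin n) (Fin n) ℝ, X.PosSemidef ∧ X.rank = 1 ∧
      ∀ i, (A i * X).trace = 0) ∧
    (∀ X : Matrix (Fin n) (Fin n) ℝ, X.PosSemidef →
      (∀ i, (A i * X).trace = 0) → X ≠ 0 → X.rank = 1) := by
  obtain ⟨t, hB, hrank⟩ := h1
  have hn : 0 < n := by
    rw [Nat.pos_iff_ne_zero]
    rintro rfl
    exact h2 t (.of_dotProduct_mulVec_pos hB.isHermitian
      fun x hx => (hx (Subsingleton.elim _ _)).elim)
  constructor
  · have hker : Module.finrank ℝ (LinearMap.ker (∑ i, t i • A i).mulVecLin) = 1 := by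
      have := LinearMap.finrank_range_add_finrank_ker (∑ i, t i • A i).mulVecLin
      rw [← Matrix.rank, hrank, Module.finrank_fin_fun] at this
      omega
    obtain ⟨⟨v, hvB⟩, hv0, hv⟩ := finrank_eq_one_iff'.1 hker
    have hv0' : v ≠ 0 := fun h => hv0 (Subtype.ext h)
    have hX0 : vecMulVec v v ≠ 0 := by simpa [vecMulVec_eq_zero] using hv0'
    refine ⟨vecMulVec v v, by simpa using posSemidef_vecMulVec_self_star v,
      le_antisymm (rank_vecMulVec_le v v) (rank_pos_of_ne_zero hX0), fun i => ?_⟩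
    rw [mul_vecMulVec, trace_vecMulVec, dotProduct_comm]
    by_contra hc
    set c := v ⬝ᵥ A i *ᵥ v with hcdef
    obtain ⟨s, hs⟩ := hB.exists_smul_add_posDef (C := c • A i)
      (by simpa [IsHermitian, conjTranspose_eq_transpose_of_trivial] using
        congrArg (c • ·) (hA i).eq)
      (by
        intro x hx hBx
        obtain ⟨a, ha⟩ := hv ⟨x, hBx⟩
        obtain rfl : a • v = x := congrArg Subtype.val ha
        have ha0 : a ≠ 0 := fun h => hx (by simp [h])
        simp only [smul_mulVec, mulVec_smul, smul_dotProduct, dotProduct_smul, smul_eq_mul,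
          ← hcdef]
        have : 0 < (a * c) ^ 2 := by positivity
        linarith)
    refine h2 (s • t + Pi.single i c) ?_
    convert hs
    simp [add_smul, Finset.sum_add_distrib, Finset.smul_sum, mul_smul, Pi.single_apply, ite_smul]
  · intro X hX hAX hX0
    have hBX : (∑ i, t i • A i) * X = 0 := hB.mul_eq_zero_of_trace_mul_eq_zero hX (by
      simp [Finset.sum_mul, trace_sum, hAX])
    have hle := rank_add_rank_le_card_of_mul_eq_zero hBX
    rw [hrank, Fintype.card_fin] at hle
    have := rank_pos_of_ne_zero hX0
    omega
end

section
/- Let A_1,…,A_m be real symmetric n×n matrices such that for every t_1,…,t_m ∈ ℝ with ∑_{i=1}^m t_i A_i positive semidefinite one has rank(∑_{i=1}^m t_i A_i) ≤ n − 2 (i.e., r* ≤ n − 2). If there is exactly one index k such that A_k is indefinite, and every A_i with i ≠ k is positive semidefinite or negative semidefinite, then the system ⟨A_i, X⟩ = 0 for i = 1,…,m, X positive semidefinite, has a rank-one solution. -/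
open Matrix

/-- Finsler's lemma: a quadratic form that is positive on the nonzero zeros of a nonnegative
quadratic form becomes positive definite after adding a large multiple of the latter. -/
theorem Matrix.exists_forall_dotProduct_add_smul_mulVec_pos {ι : Type*} [Fintype ι]
    (P B : Matrix ι ι ℝ) (hB : ∀ x, 0 ≤ x ⬝ᵥ B *ᵥ x)
    (hP : ∀ x, x ≠ 0 → x ⬝ᵥ B *ᵥ x = 0 → 0 < x ⬝ᵥ P *ᵥ x) :
    ∃ s : ℝ, ∀ x, x ≠ 0 → 0 < x ⬝ᵥ (P + s • B) *ᵥ x := by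
  have cont (M : Matrix ι ι ℝ) : Continuous fun x : ι → ℝ => x ⬝ᵥ M *ᵥ x := by fun_prop
  have hK : IsCompact (Metric.sphere (0 : ι → ℝ) 1 ∩ {x | x ⬝ᵥ P *ᵥ x ≤ 0}) :=
    (isCompact_sphere _ _).inter_right (isClosed_le (cont P) continuous_const)
  have hpos : ∀ x ∈ Metric.sphere (0 : ι → ℝ) 1 ∩ {x | x ⬝ᵥ P *ᵥ x ≤ 0},
      0 < x ⬝ᵥ B *ᵥ x := by
    rintro x ⟨hx, hxP⟩
    have hx0 : x ≠ 0 := ne_zero_of_mem_unit_sphere ⟨x, hx⟩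
    exact (hB x).lt_of_ne fun h => (hP x hx0 h.symm).not_ge hxP
  obtain ⟨c, hc⟩ := (hK.image_of_continuousOn
    ((cont P).continuousOn.neg.div (cont B).continuousOn fun x hx => (hpos x hx).ne')).bddAbove
  refine ⟨|c| + 1, ?_⟩
  have hunit : ∀ x : ι → ℝ, ‖x‖ = 1 → 0 < x ⬝ᵥ (P + (|c| + 1) • B) *ᵥ x := by
    intro x hx
    simp only [add_mulVec, smul_mulVec, dotProduct_add, dotProduct_smul, smul_eq_mul]
    by_cases h : x ⬝ᵥ P *ᵥ x ≤ 0
    · have hmem : x ∈ Metric.sphere (0 : ι → ℝ) 1 ∩ {x | x ⬝ᵥ P *ᵥ x ≤ 0} :=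
        ⟨by simpa using hx, h⟩
      have hb := hpos x hmem
      have := (div_le_iff₀ hb).1 (hc (Set.mem_image_of_mem _ hmem))
      rw [Pi.neg_apply] at this
      nlinarith [le_abs_self c]
    · have := mul_nonneg (add_nonneg (abs_nonneg c) zero_le_one) (hB x)
      linarith
  intro x hx
  have hn : 0 < ‖x‖ := norm_pos_iff.2 hx
  have := hunit (‖x‖⁻¹ • x) (by simp [norm_smul, hn.ne'])
  simp only [mulVec_smul, dotProduct_smul, smul_dotProduct, smul_eq_mul] at this
  exact pos_of_mul_pos_right (pos_of_mul_pos_right this (by positivity)) (by positivity)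

/-- If a quadratic form has no nonzero isotropic vector in the kernel of `B`, then it has a constant
sign on the nonzero vectors of that kernel. -/
theorem Matrix.forall_pos_or_forall_neg_of_mulVec_eq_zero {ι : Type*} [Fintype ι]
    (P B : Matrix ι ι ℝ)
    (h : ∀ x, x ≠ 0 → B *ᵥ x = 0 → x ⬝ᵥ P *ᵥ x ≠ 0) :
    (∀ x, x ≠ 0 → B *ᵥ x = 0 → 0 < x ⬝ᵥ P *ᵥ x) ∨
      (∀ x, x ≠ 0 → B *ᵥ x = 0 → x ⬝ᵥ P *ᵥ x < 0) := by
  by_contra! hcon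
  obtain ⟨⟨x, hx0, hxB, hx⟩, y, hy0, hyB, hy⟩ := hcon
  have hx' := hx.lt_of_ne (h x hx0 hxB)
  have hy' := hy.lt_of_ne (h y hy0 hyB).symm
  obtain ⟨t, -, ht⟩ := intermediate_value_Icc (zero_le_one (α := ℝ))
    (f := fun t : ℝ => ((1 - t) • x + t • y) ⬝ᵥ P *ᵥ ((1 - t) • x + t • y))
    (by fun_prop) (show (0 : ℝ) ∈ _ by simp [hx, hy])
  refine h _ (fun hz => ?_) (by simp [mulVec_add, mulVec_smul, hxB, hyB]) ht
  have hxy : (1 - t) • x = -(t • y) := eq_neg_of_add_eq_zero_left hz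
  have hq := congrArg (fun z => z ⬝ᵥ P *ᵥ z) hxy
  simp only [mulVec_smul, mulVec_neg, dotProduct_smul, smul_dotProduct, neg_dotProduct,
    dotProduct_neg, smul_eq_mul] at hq
  rcases eq_or_ne t 0 with rfl | ht0
  · simp at hq
    linarith
  · nlinarith [mul_pos (mul_self_pos.2 ht0) hy', mul_self_nonneg (1 - t)]

theorem Matrix.trace_mul_vecMulVec_self {ι : Type*} [Fintype ι] (M : Matrix ι ι ℝ) (x : ι → ℝ) :
    (M * vecMulVec x x).trace = x ⬝ᵥ M *ᵥ x := by
  rw [mul_vecMulVec, trace_vecMulVec, dotProduct_comm]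

theorem Matrix.rank_vecMulVec_self {ι : Type*} [Fintype ι] {x : ι → ℝ} (hx : x ≠ 0) :
    (vecMulVec x x).rank = 1 := by
  refine (rank_vecMulVec_le x x).antisymm (Nat.one_le_iff_ne_zero.2 fun h => hx ?_)
  rw [rank, Submodule.finrank_eq_zero, LinearMap.range_eq_bot] at h
  have := LinearMap.congr_fun h x
  simp [vecMulVec_mulVec, hx] at this

theorem stmt_12 {n m : ℕ}
    (A : Fin m → Matrix (Fin n) (Fin n) ℝ) (hA : ∀ i, (A i).IsSymm)
    (hr : ∀ t : Fin m → ℝ, (∑ i, t i • A i).PosSemidef →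
      (∑ i, t i • A i).rank ≤ n - 2)
    (k : Fin m)
    (hk : ¬ (A k).PosSemidef ∧ ¬ (-(A k)).PosSemidef)
    (hother : ∀ i, i ≠ k → (A i).PosSemidef ∨ (-(A i)).PosSemidef) :
    ∃ X : Matrix (Fin n) (Fin n) ℝ, X.PosSemidef ∧ X.rank = 1 ∧
      ∀ i, (A i * X).trace = 0 := by
  classical
  have hn : n ≠ 0 := by
    rintro rfl
    exact hk.1 (Subsingleton.elim 0 (A k) ▸ PosSemidef.zero)
  have hε : ∀ i, ∃ ε : ℝ, ε ≠ 0 ∧ (i ≠ k → (ε • A i).PosSemidef) := by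
    intro i
    by_cases hi : i = k
    · exact ⟨1, one_ne_zero, fun h => (h hi).elim⟩
    · rcases hother i hi with h | h
      · exact ⟨1, one_ne_zero, fun _ => by simpa using h⟩
      · exact ⟨-1, by norm_num, fun _ => by simpa using h⟩
  choose ε hε0 hε using hε
  set B := ∑ i ∈ Finset.univ.erase k, ε i • A i with hBdef
  have hB : B.PosSemidef :=
    posSemidef_sum _ fun i hi => hε i (Finset.ne_of_mem_erase hi)
  have hBq (x : Fin n → ℝ) : 0 ≤ x ⬝ᵥ B *ᵥ x := by simpa using hB.dotProduct_mulVec_nonneg x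
  have hBker (x : Fin n → ℝ) : x ⬝ᵥ B *ᵥ x = 0 ↔ B *ᵥ x = 0 := by
    simpa using hB.dotProduct_mulVec_zero_iff x
  have no_definite (σ : ℝ) :
      ¬ ∀ x, x ≠ 0 → B *ᵥ x = 0 → 0 < x ⬝ᵥ (σ • A k) *ᵥ x := by
    intro h
    obtain ⟨s, hs⟩ := exists_forall_dotProduct_add_smul_mulVec_pos (σ • A k) B hBq
      fun x hx hxB => h x hx ((hBker x).1 hxB)
    have hsum : ∑ i, (if i = k then σ else s * ε i) • A i = σ • A k + s • B := by
      rw [← Finset.add_sum_erase _ _ (Finset.mem_univ k), hBdef, Finset.smul_sum, if_pos rfl]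
      congr 1
      refine Finset.sum_congr rfl fun i hi => ?_
      rw [if_neg (Finset.ne_of_mem_erase hi), mul_smul]
    have hAk : (A k).IsHermitian := by
      rw [IsHermitian, conjTranspose_eq_transpose_of_trivial, (hA k).eq]
    have hpd : (σ • A k + s • B).PosDef :=
      .of_dotProduct_mulVec_pos
        ((hAk.smul (IsSelfAdjoint.all σ)).add (hB.1.smul (IsSelfAdjoint.all s)))
        fun x hx => by simpa using hs x hx
    have hrank := hr _ (hsum ▸ hpd.posSemidef)
    rw [hsum, rank_of_isUnit _ hpd.isUnit, Fintype.card_fin] at hrank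
    omega
  obtain ⟨x, hx0, hxB, hxk⟩ : ∃ x, x ≠ 0 ∧ B *ᵥ x = 0 ∧ x ⬝ᵥ A k *ᵥ x = 0 := by
    by_contra! h
    rcases forall_pos_or_forall_neg_of_mulVec_eq_zero (A k) B h with h | h
    · exact no_definite 1 (by simpa using h)
    · exact no_definite (-1) (by simpa [neg_mulVec] using h)
  refine ⟨vecMulVec x x, by simpa using posSemidef_vecMulVec_self_star x,
    rank_vecMulVec_self hx0, fun i => ?_⟩
  rw [trace_mul_vecMulVec_self]
  by_cases hi : i = k
  · rw [hi, hxk]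
  have hzero := (hBker x).2 hxB
  rw [hBdef, sum_mulVec, dotProduct_sum, Finset.sum_eq_zero_iff_of_nonneg fun j hj => by
    simpa using (hε j (Finset.ne_of_mem_erase hj)).dotProduct_mulVec_nonneg x] at hzero
  have := hzero i (Finset.mem_erase.2 ⟨hi, Finset.mem_univ i⟩)
  simpa [smul_mulVec, hε0 i] using this
end

section
/- Let A_1,…,A_m be real symmetric n×n matrices such that for every t_1,…,t_m ∈ ℝ with ∑_{i=1}^m t_i A_i positive semidefinite one has rank(∑_{i=1}^m t_i A_i) ≤ n − 2 (i.e., r* ≤ n − 2). Suppose there exists an index k such that A_k is indefinite and {x ∈ ℝⁿ : xᵀ A_k x = 0} ⊆ {x ∈ ℝⁿ : xᵀ A_l x = 0} for every index l ≠ k with A_l indefinite. Then the system ⟨A_i, X⟩ = 0 for i = 1,…,m, X positive semidefinite, has a rank-one solution. -/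
open Matrix

/-- A quadratic form that is positive on the nonzero kernel vectors of a positive semidefinite
matrix becomes positive definite after adding a large multiple of that matrix. -/
theorem Matrix.PosSemidef.exists_posDef_add_smul {n : Type*} [Fintype n]
    {P Q : Matrix n n ℝ} (hP : P.PosSemidef) (hQ : Q.IsHermitian)
    (h : ∀ x, x ≠ 0 → P *ᵥ x = 0 → 0 < x ⬝ᵥ Q *ᵥ x) :
    ∃ N : ℕ, (Q + (N : ℝ) • P).PosDef := by
  have hP0 (x : n → ℝ) : 0 ≤ x ⬝ᵥ P *ᵥ x := by simpa using hP.dotProduct_mulVec_nonneg x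
  have hcont (B : Matrix n n ℝ) : Continuous fun x : n → ℝ ↦ x ⬝ᵥ B *ᵥ x := by fun_prop
  have hadd (N : ℕ) (x : n → ℝ) :
      x ⬝ᵥ (Q + (N : ℝ) • P) *ᵥ x = x ⬝ᵥ Q *ᵥ x + N * (x ⬝ᵥ P *ᵥ x) := by
    simp [add_mulVec, smul_mulVec]
  obtain ⟨N, hN⟩ := (isCompact_sphere (0 : n → ℝ) 1).elim_directed_cover
    (fun N : ℕ ↦ {x | 0 < x ⬝ᵥ Q *ᵥ x + N * (x ⬝ᵥ P *ᵥ x)})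
    (fun N ↦ isOpen_lt continuous_const ((hcont Q).add ((hcont P).const_mul _)))
    (fun x hx ↦ by
      have hx0 : x ≠ 0 := by rintro rfl; simp at hx
      rw [Set.mem_iUnion]
      rcases (hP0 x).eq_or_lt with hx' | hx'
      · have := (hP.dotProduct_mulVec_zero_iff x).1 (by simpa using hx'.symm)
        exact ⟨0, by simpa using h x hx0 this⟩
      · obtain ⟨N, hN⟩ := exists_nat_gt (-(x ⬝ᵥ Q *ᵥ x) / (x ⬝ᵥ P *ᵥ x))
        rw [div_lt_iff₀ hx'] at hN
        exact ⟨N, by simp only [Set.mem_ofPred_eq]; linarith⟩)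
    (Monotone.directed_le fun M N hMN ↦ Set.ofPred_subset_ofPred.2 fun x hx ↦ by
      have : (M : ℝ) ≤ N := by exact_mod_cast hMN
      have := mul_le_mul_of_nonneg_right this (hP0 x)
      linarith)
  refine ⟨N, .of_dotProduct_mulVec_pos
    (hQ.add (hP.isHermitian.smul (IsSelfAdjoint.all _))) fun x hx ↦ ?_⟩
  have hx' : ‖x‖ ≠ 0 := norm_ne_zero_iff.2 hx
  have hmem : ‖x‖⁻¹ • x ∈ Metric.sphere (0 : n → ℝ) 1 := by
    simp [norm_smul, inv_mul_cancel₀ hx']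
  have hpos : 0 < (‖x‖⁻¹ • x) ⬝ᵥ (Q + (N : ℝ) • P) *ᵥ (‖x‖⁻¹ • x) := by
    rw [hadd]; exact hN hmem
  simp only [mulVec_smul, dotProduct_smul, smul_dotProduct, smul_eq_mul] at hpos
  rw [star_trivial]
  exact pos_of_mul_pos_right (pos_of_mul_pos_right hpos (by positivity)) (by positivity)

/-- A quadratic form taking both signs on a subspace has an isotropic vector there. -/
theorem Matrix.exists_dotProduct_mulVec_eq_zero {n : Type*} [Fintype n]
    (Q : Matrix n n ℝ) {V : Submodule ℝ (n → ℝ)} {x y : n → ℝ} (hxV : x ∈ V) (hyV : y ∈ V)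
    (hx0 : x ≠ 0) (hy0 : y ≠ 0) (hx : x ⬝ᵥ Q *ᵥ x ≤ 0) (hy : 0 ≤ y ⬝ᵥ Q *ᵥ y) :
    ∃ z ∈ V, z ≠ 0 ∧ z ⬝ᵥ Q *ᵥ z = 0 := by
  by_cases hxy : LinearIndependent ℝ ![x, y]
  · have hc : Continuous fun t : ℝ ↦
        ((1 - t) • x + t • y) ⬝ᵥ Q *ᵥ ((1 - t) • x + t • y) := by fun_prop
    obtain ⟨t, -, ht⟩ := intermediate_value_Icc (zero_le_one' ℝ) hc.continuousOn
      (show (0 : ℝ) ∈ _ by simpa using ⟨hx, hy⟩)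
    refine ⟨_, V.add_mem (V.smul_mem _ hxV) (V.smul_mem _ hyV), fun h0 ↦ ?_, ht⟩
    obtain ⟨h1, h2⟩ := LinearIndependent.pair_iff.1 hxy _ _ h0
    linarith
  · rw [LinearIndependent.pair_iff' hx0] at hxy
    push Not at hxy
    obtain ⟨c, rfl⟩ := hxy
    refine ⟨c • x, hyV, hy0, hy.antisymm' ?_⟩
    simp only [mulVec_smul, dotProduct_smul, smul_dotProduct, smul_eq_mul]
    nlinarith [mul_nonneg (mul_self_nonneg c) (neg_nonneg.2 hx)]

theorem stmt_13 {n m : ℕ}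
    (A : Fin m → Matrix (Fin n) (Fin n) ℝ) (hA : ∀ i, (A i).IsSymm)
    (hr : ∀ t : Fin m → ℝ, (∑ i, t i • A i).PosSemidef →
      (∑ i, t i • A i).rank ≤ n - 2)
    (k : Fin m)
    (hk : ¬ (A k).PosSemidef ∧ ¬ (-(A k)).PosSemidef)
    (hsub : ∀ l, l ≠ k → (¬ (A l).PosSemidef ∧ ¬ (-(A l)).PosSemidef) →
      {x : Fin n → ℝ | x ⬝ᵥ (A k) *ᵥ x = 0} ⊆ {x : Fin n → ℝ | x ⬝ᵥ (A l) *ᵥ x = 0}) :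
    ∃ X : Matrix (Fin n) (Fin n) ℝ, X.PosSemidef ∧ X.rank = 1 ∧
      ∀ i, (A i * X).trace = 0 := by
  classical
  have hn : 0 < n := by
    rcases Nat.eq_zero_or_pos n with rfl | hn
    · exact (hk.1 (Subsingleton.elim 0 (A k) ▸ .zero)).elim
    · exact hn
  have hnot_posDef (t : Fin m → ℝ) : ¬ (∑ i, t i • A i).PosDef := fun h ↦ by
    have := hr t h.posSemidef
    rw [rank_of_isUnit _ h.isUnit, Fintype.card_fin] at this
    omega
  let s : Fin m → ℝ := fun i ↦
    if (A i).PosSemidef then 1 else if (-(A i)).PosSemidef then -1 else 0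
  have hs (i : Fin m) : (s i • A i).PosSemidef := by
    simp only [s]
    split_ifs with h₁ h₂
    · simpa using h₁
    · simpa using h₂
    · simpa using PosSemidef.zero
  have hP : (∑ i, s i • A i).PosSemidef := posSemidef_sum _ fun i _ ↦ hs i
  have hker {x : Fin n → ℝ} (hx : (∑ i, s i • A i) *ᵥ x = 0) (i : Fin m) :
      s i * (x ⬝ᵥ A i *ᵥ x) = 0 := by
    have hnonneg (j : Fin m) : 0 ≤ s j * (x ⬝ᵥ A j *ᵥ x) := by
      simpa [smul_mulVec] using (hs j).dotProduct_mulVec_nonneg x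
    have hsum : ∑ j, s j * (x ⬝ᵥ A j *ᵥ x) = 0 := by
      simpa [sum_mulVec, dotProduct_sum, smul_mulVec] using congrArg (x ⬝ᵥ ·) hx
    exact (Finset.sum_eq_zero_iff_of_nonneg fun j _ ↦ hnonneg j).1 hsum i (Finset.mem_univ i)
  have hsign (c : ℝ) : ∃ x, x ≠ 0 ∧ (∑ i, s i • A i) *ᵥ x = 0 ∧ c * (x ⬝ᵥ A k *ᵥ x) ≤ 0 := by
    by_contra! h
    obtain ⟨N, hN⟩ := hP.exists_posDef_add_smul (Q := c • A k)
      ((isHermitian_iff_isSymm.2 (hA k)).smul (IsSelfAdjoint.all c))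
      (by simpa [smul_mulVec] using h)
    refine hnot_posDef (fun i ↦ (if i = k then c else 0) + N * s i) ?_
    simpa [add_smul, Finset.sum_add_distrib, mul_smul, Finset.smul_sum, ite_smul] using hN
  obtain ⟨x, hx0, hxP, hx⟩ := hsign 1
  obtain ⟨y, hy0, hyP, hy⟩ := hsign (-1)
  obtain ⟨z, hzP, hz0, hz⟩ := (A k).exists_dotProduct_mulVec_eq_zero
    (V := LinearMap.ker (∑ i, s i • A i).mulVecLin) (x := x) (y := y)
    (LinearMap.mem_ker.2 hxP) (LinearMap.mem_ker.2 hyP) hx0 hy0 (by linarith) (by linarith)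
  have hzA (i : Fin m) : z ⬝ᵥ A i *ᵥ z = 0 := by
    by_cases hik : i = k
    · exact hik ▸ hz
    have := hker (LinearMap.mem_ker.1 hzP) i
    by_cases h₁ : (A i).PosSemidef
    · simpa [s, h₁] using this
    by_cases h₂ : (-(A i)).PosSemidef
    · simpa [s, h₁, h₂] using this
    exact hsub i hik ⟨h₁, h₂⟩ hz
  refine ⟨vecMulVec z z, by simpa using posSemidef_vecMulVec_self_star z, ?_, fun i ↦ ?_⟩
  · refine (rank_vecMulVec_le z z).antisymm (Nat.one_le_iff_ne_zero.2 fun h ↦ hz0 ?_)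
    rw [rank, Submodule.finrank_eq_zero, LinearMap.range_eq_bot] at h
    simpa [vecMulVec_mulVec] using LinearMap.congr_fun h z
  · rw [mul_vecMulVec, trace_vecMulVec, dotProduct_comm, hzA]
end

section
/- Let m ≤ n − 1 and let A_1,…,A_m be real symmetric n×n matrices. If the system ⟨A_i, X⟩ = 0 for i = 1,…,m, X positive semidefinite, has no rank-one solution, then there exists a vector x ∈ ℝⁿ with ‖x‖ = 1 and x_n ∈ (−1, 0) such that xᵀ A_i x = x_i / x_n for all i = 1,…,m. -/
open Matrix

/-- A finite-dimensional field extension of `ℝ` of odd degree is `ℝ`. -/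
theorem algebraMap_real_surjective_of_odd_finrank {K : Type*} [Field K] [Algebra ℝ K]
    (hK : Odd (Module.finrank ℝ K)) : Function.Surjective (algebraMap ℝ K) := by
  intro x
  have : FiniteDimensional ℝ K := FiniteDimensional.of_finrank_pos hK.pos
  have hx : IsIntegral ℝ x := Algebra.IsIntegral.isIntegral x
  have h2 := (minpoly.irreducible hx).natDegree_le_two
  have hodd : Odd (minpoly ℝ x).natDegree := hK.of_dvd_nat (minpoly.degree_dvd hx)
  have h1 : (minpoly ℝ x).natDegree = 1 := by
    rcases hodd with ⟨k, hk⟩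
    omega
  exact minpoly.mem_range_of_degree_eq_one ℝ x
    ((Polynomial.degree_eq_iff_natDegree_eq_of_pos one_pos).2 h1)

/-- A commutative real algebra acting on a real vector space of odd dimension has a real point. -/
theorem exists_algHom_real_of_odd_finrank_module {A : Type*} [CommRing A] [Algebra ℝ A] (d : ℕ) :
    ∀ (M : Type*) [AddCommGroup M] [Module ℝ M] [Module A M] [IsScalarTower ℝ A M],
      Module.finrank ℝ M = d → Odd d → Nonempty (A →ₐ[ℝ] ℝ) := by
  induction d using Nat.strong_induction_on with
  | _ d ih =>
    intro M _ _ _ _ hd hodd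
    have : FiniteDimensional ℝ M := FiniteDimensional.of_finrank_pos (hd ▸ hodd.pos)
    have : Nontrivial M := Module.nontrivial_of_finrank_pos (R := ℝ) (hd ▸ hodd.pos)
    by_cases hs : IsSimpleModule A M
    · obtain ⟨I, hI, ⟨e⟩⟩ := isSimpleModule_iff_quot_maximal.1 hs
      let _ : Field (A ⧸ I) := Ideal.Quotient.field I
      have hfr : Odd (Module.finrank ℝ (A ⧸ I)) := by
        rw [← (e.restrictScalars ℝ).finrank_eq, hd]
        exact hodd
      have hb : Function.Bijective (Algebra.ofId ℝ (A ⧸ I)) :=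
        ⟨(algebraMap ℝ (A ⧸ I)).injective, algebraMap_real_surjective_of_odd_finrank hfr⟩
      exact ⟨(AlgEquiv.ofBijective _ hb).symm.toAlgHom.comp (Ideal.Quotient.mkₐ ℝ I)⟩
    · obtain ⟨N, hN0, hN1⟩ : ∃ N : Submodule A M, N ≠ ⊥ ∧ N ≠ ⊤ := by
        by_contra! hc
        exact hs ((isSimpleModule_iff A M).2
          { eq_bot_or_eq_top := fun N => or_iff_not_imp_left.2 (hc N) })
      have hsum : Module.finrank ℝ (M ⧸ N) + Module.finrank ℝ N = Module.finrank ℝ M :=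
        Submodule.finrank_quotient_add_finrank (N.restrictScalars ℝ)
      have hlt : Module.finrank ℝ N < Module.finrank ℝ M :=
        Submodule.finrank_lt (s := N.restrictScalars ℝ) (by simpa using hN1)
      have hpos : 0 < Module.finrank ℝ N := Nat.pos_of_ne_zero fun h0 => hN0 (by
        simpa using Submodule.finrank_eq_zero (S := N.restrictScalars ℝ) |>.1 h0)
      rcases Nat.even_or_odd (Module.finrank ℝ N) with he | ho
      · refine ih (Module.finrank ℝ (M ⧸ N)) (by omega) (M ⧸ N) rfl ?_
        rw [← hd, ← hsum] at hodd
        exact (Nat.odd_add.1 hodd).2 he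
      · exact ih (Module.finrank ℝ N) (hd ▸ hlt) N rfl ho

section MvPolynomial

open MvPolynomial

variable {σ K : Type*}

/-- Polynomials of total degree less than `d`. -/
noncomputable abbrev MvPolynomial.degreeLT (σ K : Type*) [CommRing K] (d : ℕ) :
    Submodule K (MvPolynomial σ K) :=
  restrictSupport K {s | s.degree < d}

/-- `p` is the sum of the monomial `X ^ a` and of terms of smaller total degree. -/
def MvPolynomial.HasMonicLead [CommRing K] (p : MvPolynomial σ K) (a : σ →₀ ℕ) : Prop :=
  p - monomial a 1 ∈ degreeLT σ K a.degree

theorem MvPolynomial.mul_mem_degreeLT [CommRing K] {p q : MvPolynomial σ K} {d e : ℕ}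
    (hp : p ∈ degreeLT σ K d) (hq : q ∈ degreeLT σ K (e + 1)) : p * q ∈ degreeLT σ K (d + e) := by
  have h := Submodule.mul_mem_mul hp hq
  rw [← restrictSupport_add] at h
  refine restrictSupport_mono K ?_ h
  rintro _ ⟨a, ha, b, hb, rfl⟩
  simp only [Set.mem_ofPred_eq, map_add] at *
  omega

theorem MvPolynomial.HasMonicLead.mem [CommRing K] {p : MvPolynomial σ K} {a : σ →₀ ℕ}
    (hp : HasMonicLead p a) : p ∈ degreeLT σ K (a.degree + 1) := by
  have h1 : p - monomial a 1 ∈ degreeLT σ K (a.degree + 1) :=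
    restrictSupport_mono K (fun s (hs : s.degree < a.degree) => Nat.lt_succ_of_lt hs) hp
  have h2 : (monomial a 1 : MvPolynomial σ K) ∈ degreeLT σ K (a.degree + 1) :=
    (monomial_mem_restrictSupport K).2 (Or.inl (Nat.lt_succ_self a.degree))
  simpa using add_mem h1 h2

theorem MvPolynomial.hasMonicLead_monomial [CommRing K] (a : σ →₀ ℕ) :
    HasMonicLead (monomial a 1 : MvPolynomial σ K) a := by
  simp [HasMonicLead]

theorem MvPolynomial.HasMonicLead.mul [CommRing K] {p q : MvPolynomial σ K} {a b : σ →₀ ℕ}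
    (hp : HasMonicLead p a) (hq : HasMonicLead q b) : HasMonicLead (p * q) (a + b) := by
  have h1 := mul_mem_degreeLT hp hq.mem
  have h2 := mul_mem_degreeLT hq (hasMonicLead_monomial (K := K) a).mem
  unfold HasMonicLead
  rw [map_add]
  rw [add_comm] at h2
  convert add_mem h1 h2 using 1
  rw [← one_mul (1 : K), ← monomial_mul, one_mul]
  ring

theorem MvPolynomial.HasMonicLead.pow [CommRing K] {p : MvPolynomial σ K} {a : σ →₀ ℕ}
    (hp : HasMonicLead p a) (k : ℕ) : HasMonicLead (p ^ k) (k • a) := by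
  induction k with
  | zero => simpa using hasMonicLead_monomial (σ := σ) (K := K) 0
  | succ k ih => simpa [pow_succ, succ_nsmul] using ih.mul hp

theorem MvPolynomial.HasMonicLead.prod [CommRing K] {ι : Type*} (s : Finset ι)
    {p : ι → MvPolynomial σ K} {a : ι → σ →₀ ℕ} (hp : ∀ i, HasMonicLead (p i) (a i)) :
    HasMonicLead (∏ i ∈ s, p i) (∑ i ∈ s, a i) := by
  classical
  induction s using Finset.induction_on with
  | empty => simpa using hasMonicLead_monomial (σ := σ) (K := K) 0
  | insert i s hi ih => simpa [Finset.prod_insert hi, Finset.sum_insert hi] using (hp i).mul ih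

/-- A family of polynomials with the same leading terms as the monomials is a basis. -/
theorem MvPolynomial.bijective_constr_of_hasMonicLead [CommRing K]
    {b : (σ →₀ ℕ) → MvPolynomial σ K} (hb : ∀ a, HasMonicLead (b a) a) :
    Function.Bijective ((basisMonomials σ K).constr K b) := by
  set Φ := (basisMonomials σ K).constr K b with hΦ
  have hlow : ∀ d, ∀ p ∈ degreeLT σ K (d + 1), p - Φ p ∈ degreeLT σ K d := by
    intro d p hp
    have hle : degreeLT σ K (d + 1) ≤ (degreeLT σ K d).comap (LinearMap.id - Φ) := by
      unfold degreeLT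
      rw [restrictSupport_eq_span, Submodule.span_le]
      rintro _ ⟨a, ha, rfl⟩
      have hΦa : Φ (monomial a 1) = b a := by
        simpa using (basisMonomials σ K).constr_basis K b a
      simp only [SetLike.mem_coe, Submodule.mem_comap, LinearMap.sub_apply, LinearMap.id_apply, hΦa]
      rw [← neg_sub]
      exact neg_mem (restrictSupport_mono K
        (fun s (hs : s.degree < a.degree) => lt_of_lt_of_le hs (Nat.lt_succ_iff.1 ha)) (hb a))
    exact hle hp
  have hex : ∀ p : MvPolynomial σ K, ∃ d, p ∈ degreeLT σ K d := fun p =>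
    ⟨p.support.sup Finsupp.degree + 1, fun s hs =>
      Nat.lt_succ_of_le (Finset.le_sup (f := Finsupp.degree) hs)⟩
  have hzero : ∀ p ∈ degreeLT σ K 0, p = 0 := by
    intro p hp
    rw [← support_eq_empty, ← Finset.coe_eq_empty, ← Set.subset_empty_iff]
    intro s hs
    exact absurd (hp hs) (Nat.not_lt_zero _)
  constructor
  · rw [injective_iff_map_eq_zero]
    intro p hp
    obtain ⟨d, hd⟩ := hex p
    induction d with
    | zero => exact hzero p hd
    | succ d ih => exact ih (by simpa [hp] using hlow d p hd)
  · intro p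
    obtain ⟨d, hd⟩ := hex p
    induction d generalizing p with
    | zero => exact ⟨0, by simp [hzero p hd]⟩
    | succ d ih =>
      obtain ⟨q, hq⟩ := ih _ (hlow d p hd)
      exact ⟨p + q, by rw [map_add, hq]; ring⟩

/-- If `g i` has total degree less than `N`, the quotient of the polynomial ring by the polynomials
`X i ^ N - g i` has dimension `N ^ card σ`. -/
theorem MvPolynomial.finrank_quotient_span_X_pow_sub [Field K] [Fintype σ] {N : ℕ} (hN : 0 < N)
    (g : σ → MvPolynomial σ K) (hg : ∀ i, g i ∈ degreeLT σ K N) :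
    Module.finrank K (MvPolynomial σ K ⧸ Ideal.span (Set.range fun i => X i ^ N - g i)) =
      N ^ Fintype.card σ := by
  classical
  set f : σ → MvPolynomial σ K := fun i => X i ^ N - g i with hf
  set I := Ideal.span (Set.range f) with hI
  have hfi : ∀ i, f i ∈ I := fun i => Ideal.subset_span ⟨i, rfl⟩
  have hflead : ∀ i, HasMonicLead (f i) (Finsupp.single i N) := by
    intro i
    have : f i - monomial (Finsupp.single i N) 1 = - g i := by
      simp [hf, X_pow_eq_monomial]
    unfold HasMonicLead
    rw [this, Finsupp.degree_single]
    exact neg_mem (hg i)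
  let b : (σ →₀ ℕ) → MvPolynomial σ K := fun a => ∏ i, f i ^ (a i / N) * X i ^ (a i % N)
  have hb : ∀ a, HasMonicLead (b a) a := by
    intro a
    have hX : ∀ i, HasMonicLead (X i : MvPolynomial σ K) (Finsupp.single i 1) :=
      fun i => hasMonicLead_monomial _
    convert HasMonicLead.prod Finset.univ
      fun i => ((hflead i).pow (a i / N)).mul ((hX i).pow (a i % N)) using 1
    simp only [Finsupp.smul_single, ← Finsupp.single_add, smul_eq_mul, mul_one, Nat.div_add_mod']
    exact (Finsupp.univ_sum_single a).symm
  let Φ := LinearEquiv.ofBijective _ (bijective_constr_of_hasMonicLead hb)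
  have hΦm : ∀ a, Φ (monomial a 1) = b a := fun a => by
    have h := (basisMonomials σ K).constr_basis K b a
    rwa [coe_basisMonomials] at h
  have hΦmul : ∀ i p, Φ (p * monomial (Finsupp.single i N) 1) = f i * Φ p := by
    intro i p
    have hlin : Φ.toLinearMap ∘ₗ LinearMap.mulRight K (monomial (Finsupp.single i N) 1) =
        LinearMap.mulLeft K (f i) ∘ₗ Φ.toLinearMap := by
      refine (basisMonomials σ K).ext fun a => ?_
      simp only [coe_basisMonomials, LinearMap.comp_apply, LinearMap.mulRight_apply,
        LinearMap.mulLeft_apply, LinearEquiv.coe_coe, monomial_mul, mul_one, hΦm, b]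
      rw [← Finset.mul_prod_erase _ _ (Finset.mem_univ i),
        ← Finset.mul_prod_erase _ (fun j => f j ^ (a j / N) * X j ^ (a j % N)) (Finset.mem_univ i)]
      have he : ∀ j ∈ Finset.univ.erase i, (a + Finsupp.single i N) j = a j := by
        intro j hj
        simp [Finsupp.single_eq_of_ne (Finset.ne_of_mem_erase hj)]
      rw [Finset.prod_congr rfl fun j hj => by rw [he j hj]]
      simp only [Finsupp.add_apply, Finsupp.single_eq_same, Nat.add_div_right _ hN,
        Nat.add_mod_right, pow_succ]
      ring
    exact LinearMap.congr_fun hlin p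
  let r : (σ → Fin N) → (σ →₀ ℕ) := fun a => Finsupp.equivFunOnFinite.symm fun i => (a i : ℕ)
  let ρ : MvPolynomial σ K →ₗ[K] ((σ → Fin N) → K) :=
    (LinearMap.pi fun a => lcoeff K (r a)) ∘ₗ Φ.symm.toLinearMap
  have hρ : ∀ p a, ρ p a = coeff (r a) (Φ.symm p) := fun p a => rfl
  have hr : Function.Injective r := by
    intro a a' h
    funext i
    exact Fin.ext (by simpa [r] using DFunLike.congr_fun h i)
  have hsurj : Function.Surjective ρ := by
    intro c
    refine ⟨Φ (∑ a, monomial (r a) (c a)), ?_⟩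
    funext a
    simp [hρ, coeff_sum, coeff_monomial, hr.eq_iff]
  have hker : LinearMap.ker ρ = I.restrictScalars K := by
    ext p
    simp only [LinearMap.mem_ker, Submodule.restrictScalars_mem]
    constructor
    · intro hp
      rw [← Φ.apply_symm_apply p]
      rw [(Φ.symm p).as_sum, map_sum]
      refine Ideal.sum_mem _ fun a ha => ?_
      obtain ⟨i, hi⟩ : ∃ i, N ≤ a i := by
        by_contra! hc
        have h0 := congr_fun hp fun i => ⟨a i, hc i⟩
        rw [hρ] at h0
        have : r (fun i => ⟨a i, hc i⟩) = a := by ext i; simp [r]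
        rw [this] at h0
        exact (mem_support_iff.1 ha) h0
      have ha' : monomial a (coeff a (Φ.symm p)) =
          monomial (a - Finsupp.single i N) (coeff a (Φ.symm p)) *
            monomial (Finsupp.single i N) 1 := by
        rw [monomial_mul, mul_one, tsub_add_cancel_of_le (Finsupp.single_le_iff.2 hi)]
      rw [ha', hΦmul]
      exact I.mul_mem_right _ (hfi i)
    · intro hp
      suffices h : ∀ q, ρ (q * p) = 0 by simpa using h 1
      refine Submodule.span_induction (p := fun p _ => ∀ q, ρ (q * p) = 0) ?_ ?_ ?_ ?_ hp
      · rintro _ ⟨i, rfl⟩ q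
        funext a
        rw [hρ, mul_comm, ← Φ.apply_symm_apply q, ← hΦmul, Φ.symm_apply_apply,
          coeff_mul_monomial', if_neg]
        · rfl
        · rw [Finsupp.single_le_iff]
          simp [r]
      · simp
      · intro x y _ _ hx hy q
        rw [mul_add, map_add, hx, hy, add_zero]
      · intro c x _ hx q
        rw [smul_eq_mul, ← mul_assoc]
        exact hx _
  have e : (MvPolynomial σ K ⧸ I.restrictScalars K) ≃ₗ[K] ((σ → Fin N) → K) :=
    (Submodule.quotEquivOfEq _ _ hker.symm).trans (ρ.quotKerEquivOfSurjective hsurj)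
  have hfin : Module.finrank K (MvPolynomial σ K ⧸ I.restrictScalars K) = N ^ Fintype.card σ := by
    rw [e.finrank_eq]
    simp
  exact hfin

/-- A real polynomial system `X i ^ N = g i` with `N` odd and `g i` of total degree less than `N`
has a real solution. -/
theorem MvPolynomial.exists_eval_eq_pow_of_odd [Fintype σ] {N : ℕ} (hN : Odd N)
    (g : σ → MvPolynomial σ ℝ) (hg : ∀ i, (g i).totalDegree < N) :
    ∃ u : σ → ℝ, ∀ i, u i ^ N = eval u (g i) := by
  have hg' : ∀ i, g i ∈ degreeLT σ ℝ N := fun i s hs =>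
    lt_of_le_of_lt (le_totalDegree hs) (hg i)
  obtain ⟨φ⟩ := exists_algHom_real_of_odd_finrank_module
    (A := MvPolynomial σ ℝ ⧸ Ideal.span (Set.range fun i => X i ^ N - g i)) _
    (MvPolynomial σ ℝ ⧸ Ideal.span (Set.range fun i => X i ^ N - g i))
    (finrank_quotient_span_X_pow_sub hN.pos g hg') hN.pow
  let ψ := φ.comp (Ideal.Quotient.mkₐ ℝ (Ideal.span (Set.range fun i => X i ^ N - g i)))
  refine ⟨fun i => ψ (X i), fun i => ?_⟩
  have h0 : ψ (X i ^ N - g i) = 0 := by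
    simp only [ψ, AlgHom.comp_apply, Ideal.Quotient.mkₐ_eq_mk]
    rw [Ideal.Quotient.eq_zero_iff_mem.2 (Ideal.subset_span (Set.mem_range_self i)), map_zero]
  have h1 : ψ (g i) = eval (fun i => ψ (X i)) (g i) := by
    conv_lhs => rw [aeval_unique ψ]
    rw [aeval_eq_eval]
    rfl
  rw [map_sub, map_pow, sub_eq_zero] at h0
  rw [h0, h1]

end MvPolynomial

/-- A cubic system with leading part `u ↦ ‖u‖² u`, perturbed by polynomials of quadratic growth,
has a real solution. -/
theorem exists_mul_one_add_sq_eq_neg_eval {m : ℕ} (Q : Fin m → MvPolynomial (Fin m) ℝ)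
    (hdeg : ∀ i, (Q i).totalDegree ≤ 2) {C : ℝ}
    (hC : ∀ i u, |MvPolynomial.eval u (Q i)| ≤ C * (1 + u ⬝ᵥ u)) :
    ∃ u : Fin m → ℝ, ∀ i, u i * (1 + u ⬝ᵥ u) = -MvPolynomial.eval u (Q i) := by
  have hsol : ∀ k : ℕ, ∃ u : Fin m → ℝ, ∀ i,
      u i ^ 5 = -(k + 1) * (u i * (1 + u ⬝ᵥ u) + MvPolynomial.eval u (Q i)) := by
    intro k
    let S : MvPolynomial (Fin m) ℝ := ∑ j, MvPolynomial.X j * MvPolynomial.X j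
    have hX : ∀ j : Fin m, (MvPolynomial.X j : MvPolynomial (Fin m) ℝ).totalDegree ≤ 1 :=
      fun j => (MvPolynomial.totalDegree_X j).le
    have hS : S.totalDegree ≤ 2 := MvPolynomial.totalDegree_finsetSum_le fun j _ =>
      (MvPolynomial.totalDegree_mul _ _).trans (add_le_add (hX j) (hX j))
    obtain ⟨u, hu⟩ := MvPolynomial.exists_eval_eq_pow_of_odd (N := 5) (by decide)
      (fun i => MvPolynomial.C (-(k + 1) : ℝ) * (MvPolynomial.X i * (1 + S) + Q i)) (by
        intro i
        have h1 : (1 + S).totalDegree ≤ 2 := (MvPolynomial.totalDegree_add _ _).trans (by simpa)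
        have h2 := MvPolynomial.totalDegree_mul (MvPolynomial.X i) (1 + S)
        have h3 := MvPolynomial.totalDegree_add (MvPolynomial.X i * (1 + S)) (Q i)
        have h4 := MvPolynomial.totalDegree_mul (MvPolynomial.C (-(k + 1) : ℝ))
          (MvPolynomial.X i * (1 + S) + Q i)
        rw [MvPolynomial.totalDegree_C, zero_add] at h4
        have h5 := hdeg i
        have h6 := hX i
        show MvPolynomial.totalDegree _ < 5
        omega)
    exact ⟨u, fun i => by rw [hu i]; simp [S, dotProduct]⟩
  choose u hu using hsol
  have hbound : ∀ k, u k ⬝ᵥ u k ≤ m * C ^ 2 := by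
    intro k
    set S := u k ⬝ᵥ u k with hS
    have hS' : S = ∑ i, u k i ^ 2 := by simp [hS, dotProduct, sq]
    have hS0 : 0 ≤ S := hS' ▸ Finset.sum_nonneg fun i _ => sq_nonneg _
    have hterm : ∀ i, u k i ^ 2 * (1 + S) ≤ (C ^ 2 + u k i ^ 2) / 2 * (1 + S) := by
      intro i
      have h1 : 0 ≤ u k i ^ 6 := by positivity
      have h2 : u k i * (u k i * (1 + S) + MvPolynomial.eval (u k) (Q i)) ≤ 0 := by
        have hk : (0 : ℝ) < k + 1 := by positivity
        have h6 : u k i ^ 6 =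
            -((k + 1) * (u k i * (u k i * (1 + S) + MvPolynomial.eval (u k) (Q i)))) := by
          rw [pow_succ, hu k i]
          ring
        by_contra! hneg
        have := mul_pos hk hneg
        linarith
      have h3 : -(u k i * MvPolynomial.eval (u k) (Q i)) ≤ |u k i| * (C * (1 + S)) := by
        refine (neg_le_abs _).trans ?_
        rw [abs_mul]
        exact mul_le_mul_of_nonneg_left (hC i (u k)) (abs_nonneg _)
      have h4 : |u k i| * C ≤ (C ^ 2 + u k i ^ 2) / 2 := by
        nlinarith [sq_nonneg (|u k i| - C), sq_abs (u k i)]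
      nlinarith
    have hsum : S ≤ ∑ i : Fin m, (C ^ 2 + u k i ^ 2) / 2 := by
      conv_lhs => rw [hS']
      exact Finset.sum_le_sum fun i _ => le_of_mul_le_mul_right (hterm i) (by linarith)
    rw [← Finset.sum_div, Finset.sum_add_distrib, ← hS'] at hsum
    simp only [Finset.sum_const, Finset.card_univ, Fintype.card_fin, nsmul_eq_mul] at hsum
    linarith
  have hmem : ∀ k, u k ∈ Metric.closedBall (0 : Fin m → ℝ) (Real.sqrt (m * C ^ 2)) := by
    intro k
    rw [mem_closedBall_zero_iff, pi_norm_le_iff_of_nonneg (Real.sqrt_nonneg _)]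
    intro i
    refine Real.abs_le_sqrt (le_trans ?_ (hbound k))
    rw [sq]
    exact Finset.single_le_sum (f := fun j => u k j * u k j) (fun j _ => mul_self_nonneg _)
      (Finset.mem_univ i)
  obtain ⟨w, -, φ, hφ, hlim⟩ := (isCompact_closedBall _ _).tendsto_subseq hmem
  refine ⟨w, fun i => ?_⟩
  have hcont : Continuous fun v : Fin m → ℝ => v i * (1 + v ⬝ᵥ v) + MvPolynomial.eval v (Q i) :=
    ((continuous_apply i).mul
      (continuous_const.add (Continuous.dotProduct continuous_id continuous_id))).add
      (MvPolynomial.continuous_eval (Q i))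
  have hl1 := (hcont.tendsto w).comp hlim
  have hl2 : Filter.Tendsto (fun k => -(1 / ((φ k : ℝ) + 1)) * u (φ k) i ^ 5) Filter.atTop
      (nhds (-0 * w i ^ 5)) :=
    ((tendsto_one_div_add_atTop_nhds_zero_nat.comp hφ.tendsto_atTop).neg).mul
      ((((continuous_apply i).tendsto w).comp hlim).pow 5)
  have heq := tendsto_nhds_unique (hl1.congr fun k => ?_) hl2
  · linarith
  · have hk : ((φ k : ℝ) + 1) ≠ 0 := by positivity
    simp only [Function.comp_apply]
    rw [hu (φ k) i]
    field_simp

/-- A common nonzero isotropic vector of a family of quadratic forms gives a rank-one solution. -/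
theorem exists_rank_one_of_dotProduct_mulVec_eq_zero {n ι : Type*} [Fintype n]
    (A : ι → Matrix n n ℝ) {v : n → ℝ} (hv : v ≠ 0) (h : ∀ i, v ⬝ᵥ A i *ᵥ v = 0) :
    ∃ X : Matrix n n ℝ, X.PosSemidef ∧ X.rank = 1 ∧ ∀ i, (A i * X).trace = 0 := by
  refine ⟨vecMulVec v v, by simpa using posSemidef_vecMulVec_self_star v, ?_, fun i => ?_⟩
  · refine le_antisymm (rank_vecMulVec_le v v) (Nat.one_le_iff_ne_zero.2 fun h0 => hv ?_)
    have hr := LinearMap.range_eq_bot.1 (Submodule.finrank_eq_zero.1 h0)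
    have hz : (vecMulVec v v) *ᵥ v = 0 := LinearMap.congr_fun hr v
    simpa [vecMulVec_mulVec] using hz
  · rw [mul_vecMulVec, trace_vecMulVec, dotProduct_comm]
    exact h i

theorem abs_dotProduct_mulVec_le {n : Type*} [Fintype n] (A : Matrix n n ℝ) (v : n → ℝ) :
    |v ⬝ᵥ A *ᵥ v| ≤ (∑ j, ∑ k, |A j k|) * (v ⬝ᵥ v) := by
  have hle : ∀ j, v j ^ 2 ≤ v ⬝ᵥ v := fun j => by
    rw [sq]
    exact Finset.single_le_sum (f := fun j => v j * v j) (fun j _ => mul_self_nonneg _)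
      (Finset.mem_univ j)
  generalize v ⬝ᵥ v = S at hle ⊢
  simp only [dotProduct, mulVec, Finset.mul_sum, Finset.sum_mul]
  refine (Finset.abs_sum_le_sum_abs _ _).trans (Finset.sum_le_sum fun j _ => ?_)
  refine (Finset.abs_sum_le_sum_abs _ _).trans (Finset.sum_le_sum fun k _ => ?_)
  rw [abs_mul, abs_mul, mul_left_comm]
  refine mul_le_mul_of_nonneg_left ?_ (abs_nonneg _)
  nlinarith [hle j, hle k, sq_nonneg (|v j| - |v k|), sq_abs (v j), sq_abs (v k)]

theorem stmt_15 {n m : ℕ} (hmn : m + 1 ≤ n)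
    (A : Fin m → Matrix (Fin n) (Fin n) ℝ) (hA : ∀ i, (A i).IsSymm)
    (h : ¬ ∃ X : Matrix (Fin n) (Fin n) ℝ, X.PosSemidef ∧ X.rank = 1 ∧
        ∀ i, (A i * X).trace = 0) :
    ∃ x : Fin n → ℝ, x ⬝ᵥ x = 1 ∧ x ⟨n - 1, by omega⟩ ∈ Set.Ioo (-1 : ℝ) 0 ∧
      ∀ i : Fin m,
        x ⬝ᵥ (A i) *ᵥ x = x (Fin.castLE (by omega) i) / x ⟨n - 1, by omega⟩ := by
  have hmn' : m ≤ n := by omega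
  set l : Fin n := ⟨n - 1, by omega⟩ with hl
  have hil : ∀ i : Fin m, Fin.castLE hmn' i ≠ l := fun i hi => by
    have := congr_arg Fin.val hi
    simp only [hl, Fin.val_castLE] at this
    omega
  let V : Fin n → MvPolynomial (Fin m) ℝ := fun j =>
    if hj : (j : ℕ) < m then MvPolynomial.X ⟨j, hj⟩ else if j = l then -1 else 0
  let v : (Fin m → ℝ) → Fin n → ℝ := fun u j => MvPolynomial.eval u (V j)
  have hvi : ∀ u i, v u (Fin.castLE hmn' i) = u i := fun u i => by simp [v, V]
  have hvl : ∀ u, v u l = -1 := fun u => by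
    have : ¬ n - 1 < m := by omega
    simp [v, V, hl, this]
  have hv0 : ∀ u j, (∀ i, Fin.castLE hmn' i ≠ j) → j ≠ l → v u j = 0 := fun u j hj hjl => by
    have : ¬ (j : ℕ) < m := fun hlt => hj ⟨j, hlt⟩ rfl
    simp [v, V, hjl, this]
  have hvv : ∀ u, v u ⬝ᵥ v u = 1 + u ⬝ᵥ u := by
    intro u
    rw [dotProduct, ← Finset.add_sum_erase _ _ (Finset.mem_univ l), hvl]
    have hs : ∑ j ∈ Finset.univ.erase l, v u j * v u j =
        ∑ j ∈ Finset.univ.map (Fin.castLEEmb hmn'), v u j * v u j := by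
      symm
      refine Finset.sum_subset ?_ ?_
      · intro j hj
        obtain ⟨i, -, rfl⟩ := Finset.mem_map.1 hj
        exact Finset.mem_erase.2 ⟨hil i, Finset.mem_univ _⟩
      · intro j hj hj'
        rw [hv0 u j (fun i hi => hj' (Finset.mem_map.2 ⟨i, Finset.mem_univ _, hi⟩))
          (Finset.ne_of_mem_erase hj), mul_zero]
    rw [hs, Finset.sum_map]
    simp [hvi, dotProduct]
  let Q : Fin m → MvPolynomial (Fin m) ℝ := fun i =>
    ∑ j, V j * ∑ k, MvPolynomial.C (A i j k) * V k
  have hQ : ∀ i u, MvPolynomial.eval u (Q i) = v u ⬝ᵥ A i *ᵥ v u := fun i u => by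
    simp [Q, v, dotProduct, mulVec]
  have hVdeg : ∀ j, (V j).totalDegree ≤ 1 := by
    intro j
    simp only [V]
    split_ifs <;> simp
  have hAVdeg : ∀ i j, (∑ k, MvPolynomial.C (A i j k) * V k).totalDegree ≤ 1 := fun i j =>
    MvPolynomial.totalDegree_finsetSum_le fun k _ =>
      (MvPolynomial.totalDegree_mul _ _).trans (by simpa using hVdeg k)
  have hQdeg : ∀ i, (Q i).totalDegree ≤ 2 := fun i =>
    MvPolynomial.totalDegree_finsetSum_le fun j _ =>
      (MvPolynomial.totalDegree_mul _ _).trans (add_le_add (hVdeg j) (hAVdeg i j))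
  obtain ⟨u, hu⟩ := exists_mul_one_add_sq_eq_neg_eval Q hQdeg
    (C := ∑ i, ∑ j, ∑ k, |A i j k|) (by
      intro i u
      have hu0 : 0 ≤ v u ⬝ᵥ v u := Finset.sum_nonneg fun j _ => mul_self_nonneg _
      rw [hQ, ← hvv]
      refine (abs_dotProduct_mulVec_le _ _).trans (mul_le_mul_of_nonneg_right ?_ hu0)
      exact Finset.single_le_sum (f := fun i => ∑ j, ∑ k, |A i j k|)
        (fun i _ => by positivity) (Finset.mem_univ i))
  have hupos : 0 < u ⬝ᵥ u := by
    have hnn : 0 ≤ u ⬝ᵥ u := Finset.sum_nonneg fun j _ => mul_self_nonneg _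
    refine lt_of_le_of_ne hnn fun h0 => h ?_
    have hu0 : u = 0 := dotProduct_self_eq_zero.1 h0.symm
    refine exists_rank_one_of_dotProduct_mulVec_eq_zero A (v := v u) (fun hz => ?_) fun i => ?_
    · simpa [hvl u] using congr_fun hz l
    · have := hu i
      rw [hQ, hu0] at this
      rw [hu0]
      simpa using this.symm
  set s : ℝ := (Real.sqrt (1 + u ⬝ᵥ u))⁻¹ with hs
  have hs1 : 1 < Real.sqrt (1 + u ⬝ᵥ u) := Real.lt_sqrt_of_sq_lt (by linarith)
  have hspos : 0 < s := inv_pos.2 (by linarith)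
  have hslt : s < 1 := inv_lt_one_of_one_lt₀ hs1
  have hss : s * (s * (1 + u ⬝ᵥ u)) = 1 := by
    rw [← mul_assoc, hs, ← mul_inv, Real.mul_self_sqrt (by linarith)]
    exact inv_mul_cancel₀ (by linarith)
  refine ⟨s • v u, ?_, ?_, fun i => ?_⟩
  · rw [smul_dotProduct, dotProduct_smul, hvv]
    exact hss
  · simp only [Pi.smul_apply, hvl, smul_eq_mul]
    constructor <;> linarith
  · rw [mulVec_smul, smul_dotProduct, dotProduct_smul, ← hQ, Pi.smul_apply, Pi.smul_apply, hvl, hvi,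
      eq_neg_iff_add_eq_zero.2 ((add_comm _ _).trans (eq_neg_iff_add_eq_zero.1 (hu i)))]
    simp only [smul_eq_mul]
    field_simp
    linear_combination (-u i) * hss
end
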